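/- arXiv:1504.07793 — 3 statements merged into one kernel-verified Lean document; each statement's English description precedes it below -/
import Mathlib

section
/- Let Φ : H → ℝ ∪ {+∞} be a proper, convex, lower semicontinuous function on a real Hilbert space H, let λ > 0, let ε : [0,+∞) → [0,+∞) be a nonnegative locally integrable function, and let (x₀, v₀) ∈ H × H satisfy v₀ ∈ ∂Φ(x₀). Then there exists a unique strong global solution (x(·), v(·)) : [0,+∞) → H × H of the Cauchy problem: v(t) ∈ ∂Φ(x(t)) for all t ≥ 0, λẋ(t) + v̇(t) + v(t) + ε(t)x(t) = 0 for almost all t ≥ 0, and x(0) = x₀, v(0) = v₀. -/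
noncomputable section
open MeasureTheory Filter Set
open scoped InnerProductSpace RealInnerProductSpace Topology ENNReal

variable {H : Type*} [NormedAddCommGroup H] [InnerProductSpace ℝ H] [CompleteSpace H]

/-- The subdifferential of an extended-real-valued convex function:
`∂Φ(x) = {p : Φ(y) ≥ Φ(x) + ⟨p, y - x⟩ for all y}`. -/
def subdiff (Φ : H → EReal) (x : H) : Set H :=
  {p : H | ∀ y : H, Φ x + ((⟪p, y - x⟫ : ℝ) : EReal) ≤ Φ y}

/-- A proper function: never takes the value `⊥` and is not identically `⊤`. -/
def ProperFn (Φ : H → EReal) : Prop := (∀ x, Φ x ≠ ⊥) ∧ ∃ x, Φ x ≠ ⊤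

/-- Convexity for extended-real-valued functions. -/
def EConvexOn (Φ : H → EReal) : Prop :=
  ∀ x y : H, ∀ a b : ℝ, 0 ≤ a → 0 ≤ b → a + b = 1 →
    Φ (a • x + b • y) ≤ (a : EReal) * Φ x + (b : EReal) * Φ y

/-- The Fenchel conjugate `f*(u) = sup_x (⟨x, u⟩ - f(x))`. -/
def fenchel (Φ : H → EReal) (u : H) : EReal := ⨆ x : H, ((⟪x, u⟫ : ℝ) : EReal) - Φ x

/-- The Moreau envelope of parameter `γ`: `f_γ(x) = inf_ξ (f(ξ) + (1/(2γ))‖x - ξ‖²)`. -/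
def moreau (γ : ℝ) (Φ : H → EReal) (x : H) : EReal :=
  ⨅ ξ : H, Φ ξ + (((1 / (2 * γ)) * ‖x - ξ‖ ^ 2 : ℝ) : EReal)

/-- The support function `σ_C(z) = sup_{c ∈ C} ⟨z, c⟩`. -/
def suppFn (C : Set H) (z : H) : EReal := ⨆ c ∈ C, ((⟪z, c⟫ : ℝ) : EReal)

/-- Map an extended real number to `ℝ≥0∞` (sending `⊤` to `⊤` and negatives to `0`). -/
def eToENN (x : EReal) : ℝ≥0∞ := if x = ⊤ then ⊤ else ENNReal.ofReal x.toReal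

/-- `(x, v)` is a strong global solution of the regularized Newton dynamic
`v(t) ∈ ∂Φ(x(t))`, `λ ẋ(t) + v̇(t) + v(t) + ε(t) x(t) = 0`:
`x, v` are absolutely continuous on compact subintervals of `[0, ∞)` (encoded by the
existence of locally integrable derivatives together with the fundamental theorem of
calculus representation), the inclusion holds everywhere on `[0, ∞)`, and the
differential equation holds almost everywhere on `[0, ∞)`. -/
def IsStrongSol (Φ : H → EReal) (lam : ℝ) (ε : ℝ → ℝ) (x v : ℝ → H) : Prop :=
  ∃ x' v' : ℝ → H,
    (∀ b : ℝ, 0 < b → IntervalIntegrable x' volume 0 b ∧ IntervalIntegrable v' volume 0 b) ∧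
    (∀ t : ℝ, 0 ≤ t → x t = x 0 + ∫ s in (0:ℝ)..t, x' s) ∧
    (∀ t : ℝ, 0 ≤ t → v t = v 0 + ∫ s in (0:ℝ)..t, v' s) ∧
    (∀ t : ℝ, 0 ≤ t → v t ∈ subdiff Φ (x t)) ∧
    (∀ᵐ t ∂(volume.restrict (Set.Ici (0:ℝ))),
      lam • x' t + v' t + v t + ε t • x t = 0)

lemma ac_of_dist_le {X : Type*} [PseudoMetricSpace X] {f : ℝ → X} {G : ℝ → ℝ} {a b : ℝ}
    (hG : AbsolutelyContinuousOnInterval G a b)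
    (h : ∀ s ∈ uIcc a b, ∀ t ∈ uIcc a b, dist (f s) (f t) ≤ dist (G s) (G t)) :
    AbsolutelyContinuousOnInterval f a b := by
  rw [absolutelyContinuousOnInterval_iff] at hG ⊢
  intro e he
  obtain ⟨δ, hδ, H⟩ := hG e he
  refine ⟨δ, hδ, fun E hE hs => lt_of_le_of_lt ?_ (H E hE hs)⟩
  refine Finset.sum_le_sum fun i hi => ?_
  have := hE.1 i hi
  exact h _ this.1 _ this.2

lemma locInt_ii {E : Type*} [NormedAddCommGroup E] {f : ℝ → E} (hf : LocallyIntegrable f volume)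
    (a b : ℝ) : IntervalIntegrable f volume a b :=
  intervalIntegrable_iff.mpr <|
      (hf.integrableOn_isCompact isCompact_uIcc).mono_set uIoc_subset_uIcc

lemma integral_exp_weight {k : ℝ → ℝ} (hk : LocallyIntegrable k volume) (hk0 : ∀ t, 0 ≤ k t)
    {t : ℝ} (ht : 0 ≤ t) :
    ∫ s in (0:ℝ)..t, k s * Real.exp (2 * ∫ r in (0:ℝ)..s, k r)
      = (Real.exp (2 * ∫ r in (0:ℝ)..t, k r) - 1) / 2 := by
  set K : ℝ → ℝ := fun s => ∫ r in (0:ℝ)..s, k r with hK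
  have hKac : AbsolutelyContinuousOnInterval K 0 t :=
    (locInt_ii hk 0 t).absolutelyContinuousOnInterval_intervalIntegral (by simp)
  have hmono : Monotone K := by
    intro a b hab
    have : K b - K a = ∫ r in a..b, k r := by
      simp only [hK]
      rw [intervalIntegral.integral_interval_sub_left (locInt_ii hk _ _) (locInt_ii hk _ _)]
    have h2 : 0 ≤ ∫ r in a..b, k r := intervalIntegral.integral_nonneg hab fun _ _ => hk0 _
    linarith
  have hE : AbsolutelyContinuousOnInterval (fun s => Real.exp (2 * K s) / 2) 0 t := by
    refine ac_of_dist_le (hKac.const_mul (Real.exp (2 * K t))) ?_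
    rw [uIcc_of_le ht]
    intro a ha b hb
    wlog hab : a ≤ b generalizing a b
    · rw [dist_comm, dist_comm (Real.exp (2 * K t) * K a)]
      exact this b hb a ha (by linarith)
    have h1 := hmono hab
    have h2 := hmono hb.2
    have h3 : Real.exp (2 * K a) ≤ Real.exp (2 * K b) := Real.exp_le_exp.2 (by linarith)
    have h4 : Real.exp (2 * K b) ≤ Real.exp (2 * K t) := Real.exp_le_exp.2 (by linarith)
    have h5 : Real.exp (2 * K a) = Real.exp (2 * K b) * Real.exp (2 * K a - 2 * K b) := by
      rw [← Real.exp_add]; ring_nf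
    have h6 := Real.add_one_le_exp (2 * K a - 2 * K b)
    rw [dist_comm, dist_comm (Real.exp (2 * K t) * K a), Real.dist_eq, Real.dist_eq,
      abs_of_nonneg (by linarith), abs_of_nonneg (by
        have := mul_le_mul_of_nonneg_left h1 (Real.exp_pos (2 * K t)).le
        linarith)]
    have h7 := mul_le_mul_of_nonneg_left h6 (Real.exp_pos (2 * K b)).le
    have h8 := mul_le_mul_of_nonneg_right h4 (sub_nonneg.2 h1)
    nlinarith
  have := hE.integral_deriv_eq_sub
  have hK0 : K 0 = 0 := by simp [hK]
  simp only [hK0, mul_zero, Real.exp_zero] at this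
  rw [sub_div, ← this]
  apply intervalIntegral.integral_congr_ae
  filter_upwards [LocallyIntegrable.ae_hasDerivAt_integral hk] with s hs _
  have h1 : HasDerivAt K (k s) s := hs 0
  have h2 := ((h1.const_mul 2).exp.div_const 2).deriv
  rw [h2]; ring

lemma orthonormal_countable {E ι : Type*} [NormedAddCommGroup E] [InnerProductSpace ℝ E]
    [TopologicalSpace.SeparableSpace E] {b : ι → E} (hb : Orthonormal ℝ b) : Countable ι := by
  have hd : Pairwise (Function.onFun Disjoint (fun i => Metric.ball (b i) (1/2))) := by
    intro i j hij
    apply Metric.ball_disjoint_ball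
    have h : ‖b i - b j‖ ^ 2 = 2 := by
      rw [norm_sub_sq_real, hb.1 i, hb.1 j, hb.2 hij]; norm_num
    rw [dist_eq_norm]
    nlinarith [norm_nonneg (b i - b j)]
  exact hd.countable_of_isOpen_disjoint (fun i => Metric.isOpen_ball)
    (fun i => Metric.nonempty_ball.2 (by norm_num))

lemma rnp_sep {E : Type*} [NormedAddCommGroup E] [InnerProductSpace ℝ E] [CompleteSpace E]
    [TopologicalSpace.SeparableSpace E] {f : ℝ → E} {h : ℝ → ℝ}
    (hh : LocallyIntegrable h volume) (hh0 : ∀ t, 0 ≤ h t)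
    (hf : ∀ s t, s ≤ t → ‖f t - f s‖ ≤ ∫ r in s..t, h r) :
    ∃ f' : ℝ → E, LocallyIntegrable f' volume ∧ ∀ s t, f t = f s + ∫ r in s..t, f' r := by
  obtain ⟨w, b, -⟩ := exists_hilbertBasis ℝ E
  have : Countable w := orthonormal_countable b.orthonormal
  set P : ℝ → ℝ := fun s => ∫ r in (0:ℝ)..s, h r with hP
  have hPsub : ∀ s t, P t - P s = ∫ r in s..t, h r := fun s t => by
    simp only [hP]
    rw [intervalIntegral.integral_interval_sub_left (locInt_ii hh _ _) (locInt_ii hh _ _)]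
  have hfP : ∀ s t, ‖f t - f s‖ ≤ |P t - P s| := by
    intro s t
    rcases le_total s t with hst | hst
    · rw [hPsub]; exact (hf s t hst).trans (le_abs_self _)
    · rw [abs_sub_comm, norm_sub_rev, hPsub]; exact (hf t s hst).trans (le_abs_self _)
  have hPac : ∀ a c, AbsolutelyContinuousOnInterval P a c := by
    intro a c
    have h0 : AbsolutelyContinuousOnInterval P (min (min a c) 0) (max (max a c) 0) :=
      (locInt_ii hh _ _).absolutelyContinuousOnInterval_intervalIntegral (by
        rw [uIcc_of_le (by simp)]; simp)
    refine h0.mono ?_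
    rw [uIcc_of_le (a := min (min a c) 0) (by simp)]
    intro x hx
    rw [mem_uIcc] at hx
    simp only [mem_Icc, min_le_iff, le_max_iff]
    tauto
  have hcac : ∀ (i : w) a c, AbsolutelyContinuousOnInterval (fun t => ⟪b i, f t⟫) a c := by
    intro i a c
    refine ac_of_dist_le (hPac a c) fun s _ t _ => ?_
    rw [dist_comm, dist_comm (P s), Real.dist_eq, Real.dist_eq, ← inner_sub_right]
    refine (abs_real_inner_le_norm _ _).trans ?_
    rw [b.orthonormal.1 i, one_mul]
    exact hfP s t
  set d : w → ℝ → ℝ := fun i t => deriv (fun t => ⟪b i, f t⟫) t with hd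
  have hdiff : ∀ᵐ t, ∀ i : w, HasDerivAt (fun t => ⟪b i, f t⟫) (d i t) t := by
    rw [ae_all_iff]
    intro i
    have : ∀ᵐ t, ∀ n : ℕ, t ∈ uIcc (-(n:ℝ)) n → DifferentiableAt ℝ (fun t => ⟪b i, f t⟫) t := by
      rw [ae_all_iff]; intro n; exact (hcac i _ _).ae_differentiableAt
    filter_upwards [this] with t ht
    obtain ⟨n, hn⟩ := exists_nat_ge |t|
    refine (ht n ?_).hasDerivAt
    rw [uIcc_of_le (by linarith [abs_nonneg t])]
    exact abs_le.1 hn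
  have hbd : ∀ᵐ t, ∀ F : Finset w, ∑ i ∈ F, d i t ^ 2 ≤ h t ^ 2 := by
    filter_upwards [hdiff, LocallyIntegrable.ae_hasDerivAt_integral hh] with t ht hht F
    have h1 : Tendsto (fun y => ∑ i ∈ F, (slope (fun t => ⟪b i, f t⟫) t y) ^ 2) (𝓝[≠] t)
        (𝓝 (∑ i ∈ F, d i t ^ 2)) :=
      tendsto_finsetSum _ fun i _ => ((hasDerivAt_iff_tendsto_slope.1 (ht i)).pow 2)
    have h2 : Tendsto (fun y => (slope P t y) ^ 2) (𝓝[≠] t) (𝓝 (h t ^ 2)) :=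
      (hasDerivAt_iff_tendsto_slope.1 (hht 0)).pow 2
    refine le_of_tendsto_of_tendsto' h1 h2 fun y => ?_
    have h3 := b.orthonormal.sum_inner_products_le (x := f y - f t) (s := F)
    have h4 : ‖f y - f t‖ ^ 2 ≤ (P y - P t) ^ 2 := by
      rw [← sq_abs (P y - P t)]; gcongr; exact hfP t y
    simp only [slope, smul_eq_mul, vsub_eq_sub, mul_pow]
    rw [← Finset.mul_sum]
    refine mul_le_mul_of_nonneg_left ?_ (sq_nonneg _)
    refine le_trans (le_of_eq ?_) (h3.trans h4)
    refine Finset.sum_congr rfl fun i _ => ?_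
    rw [← inner_sub_right, Real.norm_eq_abs, sq_abs]
  have hsum : ∀ᵐ t, ∃ y : E, HasSum (fun i => d i t • b i) y ∧ (∀ i, ⟪b i, y⟫ = d i t) ∧
      ‖y‖ ≤ h t := by
    filter_upwards [hbd] with t ht
    have hm : Memℓp (fun i => d i t) 2 := by
      apply memℓp_gen' (C := h t ^ 2)
      intro s
      simpa using ht s
    refine ⟨b.repr.symm ⟨fun i => d i t, hm⟩, b.hasSum_repr_symm _, ?_, ?_⟩
    · intro i
      rw [← b.repr_apply_apply]; simp
    · rw [LinearIsometryEquiv.norm_map]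
      apply lp.norm_le_of_forall_sum_le (by norm_num) (hh0 t)
      intro s
      simpa using ht s
  choose! f' hf' using fun t (ht : ∃ y : E, HasSum (fun i => d i t • b i) y ∧
    (∀ i, ⟪b i, y⟫ = d i t) ∧ ‖y‖ ≤ h t) => ht
  have hmeas : AEStronglyMeasurable f' volume := by
    refine aestronglyMeasurable_of_tendsto_ae (atTop : Filter (Finset w))
      (f := fun F t => ∑ i ∈ F, d i t • b i) ?_ ?_
    · intro F
      refine Finset.aestronglyMeasurable_fun_sum _ fun i _ => ?_
      exact ((measurable_deriv _).aestronglyMeasurable).smul_const _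
    · filter_upwards [hsum] with t ht
      exact (hf' t ht).1
  have hIntg : LocallyIntegrable f' volume := by
    refine hh.mono hmeas ?_
    filter_upwards [hsum] with t ht
    exact ((hf' t ht).2.2).trans (le_abs_self _)
  refine ⟨f', hIntg, fun s t => ?_⟩
  apply b.repr.injective
  ext i
  rw [b.repr_apply_apply, b.repr_apply_apply, inner_add_right]
  have h1 : ⟪b i, ∫ r in s..t, f' r⟫ = ∫ r in s..t, ⟪b i, f' r⟫ := by
    exact ((innerSL ℝ (b i)).intervalIntegral_comp_comm (locInt_ii hIntg s t)).symm
  have h2 : ∫ r in s..t, ⟪b i, f' r⟫ = ∫ r in s..t, d i r := by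
    apply intervalIntegral.integral_congr_ae
    filter_upwards [hsum] with r hr _
    exact (hf' r hr).2.1 i
  rw [h1, h2, (hcac i s t).integral_deriv_eq_sub]
  ring

lemma rnp {E : Type*} [NormedAddCommGroup E] [InnerProductSpace ℝ E] [CompleteSpace E]
    {f : ℝ → E} {h : ℝ → ℝ} (hfc : Continuous f)
    (hh : LocallyIntegrable h volume) (hh0 : ∀ t, 0 ≤ h t)
    (hf : ∀ s t, s ≤ t → ‖f t - f s‖ ≤ ∫ r in s..t, h r) :
    ∃ f' : ℝ → E, LocallyIntegrable f' volume ∧ ∀ s t, f t = f s + ∫ r in s..t, f' r := by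
  set S : Submodule ℝ E := (Submodule.span ℝ (range f)).topologicalClosure with hS
  have hsep : TopologicalSpace.IsSeparable (S : Set E) := by
    have := ((TopologicalSpace.isSeparable_range hfc).span (R := ℝ)).closure
    exact this
  have : TopologicalSpace.SeparableSpace S := hsep.separableSpace
  have : CompleteSpace S := (Submodule.isClosed_topologicalClosure _).completeSpace_coe
  have hfS : ∀ t, f t ∈ S := fun t =>
    Submodule.le_topologicalClosure _ (Submodule.subset_span (mem_range_self t))
  obtain ⟨g', hg', hg⟩ := rnp_sep (f := fun t => (⟨f t, hfS t⟩ : S)) hh hh0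
    (fun s t hst => hf s t hst)
  refine ⟨fun t => (g' t : E), ?_, fun s t => ?_⟩
  · refine hg'.mono ?_ ?_
    · exact S.subtypeL.continuous.comp_aestronglyMeasurable hg'.aestronglyMeasurable
    · exact Eventually.of_forall fun t => le_rfl
  · have := congrArg (S.subtypeL) (hg s t)
    rw [map_add, ← ContinuousLinearMap.intervalIntegral_comp_comm _ (locInt_ii hg' s t)] at this
    exact this

lemma phi_convex {Φ : H → EReal} (hproper : ProperFn Φ) (hconv : EConvexOn Φ) {x y : H}
    (hx : Φ x ≠ ⊤) (hy : Φ y ≠ ⊤) {a b : ℝ} (ha : 0 ≤ a) (hb : 0 ≤ b) (hab : a + b = 1) :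
    Φ (a • x + b • y) ≠ ⊤ ∧
      (Φ (a • x + b • y)).toReal ≤ a * (Φ x).toReal + b * (Φ y).toReal := by
  have h := hconv x y a b ha hb hab
  have e1 := EReal.coe_toReal hx (hproper.1 x)
  have e2 := EReal.coe_toReal hy (hproper.1 y)
  rw [← e1, ← e2, ← EReal.coe_mul, ← EReal.coe_mul, ← EReal.coe_add] at h
  have h1 : Φ (a • x + b • y) ≠ ⊤ := ne_top_of_le_ne_top (EReal.coe_ne_top _) h
  refine ⟨h1, ?_⟩
  rw [← EReal.coe_toReal h1 (hproper.1 _)] at h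
  exact_mod_cast h

lemma subdiff_dom {Φ : H → EReal} (hproper : ProperFn Φ) {x v : H} (h : v ∈ subdiff Φ x) :
    Φ x ≠ ⊤ := by
  intro hx
  obtain ⟨y, hy⟩ := hproper.2
  have := h y
  rw [hx, EReal.top_add_coe] at this
  exact hy (top_le_iff.1 this)

lemma subdiff_real {Φ : H → EReal} (hproper : ProperFn Φ) {x v y : H} (h : v ∈ subdiff Φ x)
    (hy : Φ y ≠ ⊤) : (Φ x).toReal + ⟪v, y - x⟫ ≤ (Φ y).toReal := by
  have h1 := h y
  rw [← EReal.coe_toReal (subdiff_dom hproper h) (hproper.1 x),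
    ← EReal.coe_toReal hy (hproper.1 y)] at h1
  exact_mod_cast h1

lemma subdiff_of_real {Φ : H → EReal} (hproper : ProperFn Φ) {x v : H} (hx : Φ x ≠ ⊤)
    (h : ∀ y, Φ y ≠ ⊤ → (Φ x).toReal + ⟪v, y - x⟫ ≤ (Φ y).toReal) : v ∈ subdiff Φ x := by
  intro y
  by_cases hy : Φ y = ⊤
  · rw [hy]; exact le_top
  rw [← EReal.coe_toReal hx (hproper.1 x), ← EReal.coe_toReal hy (hproper.1 y)]
  exact_mod_cast h y hy

lemma subdiff_mono {Φ : H → EReal} (hproper : ProperFn Φ) {x v y w : H} (h : v ∈ subdiff Φ x)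
    (h' : w ∈ subdiff Φ y) : 0 ≤ ⟪v - w, x - y⟫ := by
  have h1 := subdiff_real hproper h (subdiff_dom hproper h')
  have h2 := subdiff_real hproper h' (subdiff_dom hproper h)
  rw [← neg_sub x y, inner_neg_right] at h1
  rw [inner_sub_left]
  linarith

lemma prox_exists {Φ : H → EReal} (hproper : ProperFn Φ) (hconv : EConvexOn Φ)
    (hlsc : LowerSemicontinuous Φ) {lam : ℝ} (hlam : 0 < lam) {x₀ v₀ : H}
    (h₀ : v₀ ∈ subdiff Φ x₀) (z : H) : ∃ x, lam • (z - x) ∈ subdiff Φ x := by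
  set q : H → ℝ := fun ξ => (Φ ξ).toReal + lam / 2 * ‖z - ξ‖ ^ 2 with hq
  set S : Set ℝ := q '' {ξ | Φ ξ ≠ ⊤} with hS
  have hne : S.Nonempty := ⟨_, x₀, subdiff_dom hproper h₀, rfl⟩
  have hbdd : BddBelow S := by
    refine ⟨(Φ x₀).toReal + ⟪v₀, z - x₀⟫ - ‖v₀‖ ^ 2 / (2 * lam), ?_⟩
    rintro _ ⟨ξ, hξ, rfl⟩
    have h1 := subdiff_real hproper h₀ hξ
    have h2 : ξ - x₀ = (z - x₀) - (z - ξ) := by abel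
    rw [h2, inner_sub_right] at h1
    have h3 := real_inner_le_norm v₀ (z - ξ)
    have h4 : ‖v₀‖ * ‖z - ξ‖ ≤ ‖v₀‖ ^ 2 / (2 * lam) + lam / 2 * ‖z - ξ‖ ^ 2 := by
      have : ‖v₀‖ ^ 2 / (2 * lam) + lam / 2 * ‖z - ξ‖ ^ 2 - ‖v₀‖ * ‖z - ξ‖
        = (‖v₀‖ - lam * ‖z - ξ‖) ^ 2 / (2 * lam) := by field_simp; ring
      have h5 : 0 ≤ (‖v₀‖ - lam * ‖z - ξ‖) ^ 2 / (2 * lam) := by positivity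
      linarith
    simp only [hq]
    linarith
  set m := sInf S with hm
  have hmle : ∀ ξ, Φ ξ ≠ ⊤ → m ≤ q ξ := fun ξ hξ => csInf_le hbdd ⟨ξ, hξ, rfl⟩
  have hseq : ∀ n : ℕ, ∃ ξ, Φ ξ ≠ ⊤ ∧ q ξ < m + 1 / ((n:ℝ) + 1) := by
    intro n
    obtain ⟨_, ⟨ξ, hξ, rfl⟩, h⟩ := exists_lt_of_csInf_lt hne
      (show sInf S < m + 1 / ((n:ℝ) + 1) from lt_add_of_pos_right _ (by positivity))
    exact ⟨ξ, hξ, h⟩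
  choose ξ hξ hqξ using hseq
  have hpar : ∀ a b, Φ a ≠ ⊤ → Φ b ≠ ⊤ → lam / 8 * ‖a - b‖ ^ 2 ≤ (q a + q b) / 2 - m := by
    intro a b ha hb
    obtain ⟨h1, h2⟩ := phi_convex hproper hconv ha hb (a := 1/2) (b := 1/2) (by norm_num)
      (by norm_num) (by norm_num)
    have h3 := hmle _ h1
    simp only [hq] at h3 ⊢
    have h4 : ‖z - ((1/2:ℝ) • a + (1/2:ℝ) • b)‖ ^ 2
        = (‖z - a‖ ^ 2 + ‖z - b‖ ^ 2) / 2 - ‖a - b‖ ^ 2 / 4 := by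
      have e1 : z - ((1/2:ℝ) • a + (1/2:ℝ) • b) = (1/2:ℝ) • ((z - a) + (z - b)) := by
        module
      have e2 : a - b = (z - b) - (z - a) := by abel
      rw [e1, e2, norm_smul, mul_pow, norm_add_sq_real, norm_sub_sq_real (z - b) (z - a),
        real_inner_comm (z - a) (z - b), Real.norm_eq_abs, sq_abs]
      ring
    rw [h4] at h3
    nlinarith
  have hcau : CauchySeq ξ := by
    rw [Metric.cauchySeq_iff']
    intro e he
    obtain ⟨N, hN⟩ := exists_nat_one_div_lt (show (0:ℝ) < lam / 8 * e ^ 2 by positivity)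
    refine ⟨N, fun n hn => ?_⟩
    have h1 := hpar _ _ (hξ n) (hξ N)
    have h2 := hqξ n
    have h3 := hqξ N
    have h4 : 1 / ((n:ℝ) + 1) ≤ 1 / ((N:ℝ) + 1) := by
      have : (N:ℝ) ≤ n := by exact_mod_cast hn
      gcongr
    have h5 : lam / 8 * ‖ξ n - ξ N‖ ^ 2 < lam / 8 * e ^ 2 := by linarith
    have h6 : ‖ξ n - ξ N‖ ^ 2 < e ^ 2 := lt_of_mul_lt_mul_left h5 (by positivity)
    rw [dist_eq_norm]
    exact lt_of_pow_lt_pow_left₀ 2 he.le h6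
  obtain ⟨x, hx⟩ := cauchySeq_tendsto_of_complete hcau
  have hle : Φ x ≤ ((m - lam / 2 * ‖z - x‖ ^ 2 : ℝ) : EReal) := by
    by_contra hcon
    push Not at hcon
    obtain ⟨c, hc1, hc2⟩ := EReal.lt_iff_exists_real_btwn.1 hcon
    have hc1' : m - lam / 2 * ‖z - x‖ ^ 2 < c := by exact_mod_cast hc1
    have hev : ∀ᶠ n in atTop, (c : EReal) < Φ (ξ n) := hx.eventually (hlsc x c hc2)
    have hlim : Tendsto (fun n : ℕ => m + 1 / ((n:ℝ) + 1) - lam / 2 * ‖z - ξ n‖ ^ 2) atTop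
        (𝓝 (m + 0 - lam / 2 * ‖z - x‖ ^ 2)) :=
      (tendsto_const_nhds.add tendsto_one_div_add_atTop_nhds_zero_nat).sub
        (((tendsto_const_nhds.sub hx).norm.pow 2).const_mul _)
    have := ge_of_tendsto hlim (b := c) (by
      filter_upwards [hev] with n hn
      rw [← EReal.coe_toReal (hξ n) (hproper.1 _)] at hn
      have hn' : c < (Φ (ξ n)).toReal := by exact_mod_cast hn
      have := hqξ n
      simp only [hq] at this
      linarith)
    linarith
  have hxD : Φ x ≠ ⊤ := ne_top_of_le_ne_top (EReal.coe_ne_top _) hle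
  rw [← EReal.coe_toReal hxD (hproper.1 _)] at hle
  have hle' : (Φ x).toReal ≤ m - lam / 2 * ‖z - x‖ ^ 2 := by exact_mod_cast hle
  refine ⟨x, subdiff_of_real hproper hxD fun y hy => ?_⟩
  have key : ∀ n : ℕ, 0 ≤ (Φ y).toReal - (Φ x).toReal - lam * ⟪z - x, y - x⟫
      + 1 / ((n:ℝ) + 1) * (lam / 2 * ‖y - x‖ ^ 2) := by
    intro n
    set t : ℝ := 1 / ((n:ℝ) + 1) with ht
    have ht0 : 0 < t := by positivity
    have ht1 : t ≤ 1 := by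
      rw [ht, div_le_one (by positivity)]; linarith [Nat.cast_nonneg (α := ℝ) n]
    obtain ⟨h1, h2⟩ := phi_convex hproper hconv hxD hy (a := 1 - t) (b := t) (by linarith)
      ht0.le (by ring)
    have h3 := hmle _ h1
    simp only [hq] at h3
    have e1 : z - ((1 - t) • x + t • y) = (z - x) - t • (y - x) := by module
    rw [e1, norm_sub_sq_real, inner_smul_right, norm_smul, mul_pow, Real.norm_eq_abs,
      sq_abs] at h3
    have h4 : 0 ≤ t * ((Φ y).toReal - (Φ x).toReal - lam * ⟪z - x, y - x⟫
      + t * (lam / 2 * ‖y - x‖ ^ 2)) := by nlinarith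
    exact nonneg_of_mul_nonneg_right h4 ht0
  have hlim : Tendsto (fun n : ℕ => (Φ y).toReal - (Φ x).toReal - lam * ⟪z - x, y - x⟫
      + 1 / ((n:ℝ) + 1) * (lam / 2 * ‖y - x‖ ^ 2)) atTop
      (𝓝 ((Φ y).toReal - (Φ x).toReal - lam * ⟪z - x, y - x⟫ + 0 * (lam / 2 * ‖y - x‖ ^ 2))) :=
    tendsto_const_nhds.add (tendsto_one_div_add_atTop_nhds_zero_nat.mul_const _)
  have := ge_of_tendsto' hlim key
  rw [inner_smul_left]
  simp only [conj_trivial]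
  linarith

lemma prox_nonexp {Φ : H → EReal} (hproper : ProperFn Φ) {lam : ℝ} (hlam : 0 < lam)
    {z w x y : H} (hx : lam • (z - x) ∈ subdiff Φ x) (hy : lam • (w - y) ∈ subdiff Φ y) :
    ‖x - y‖ ≤ ‖z - w‖ := by
  have h := subdiff_mono hproper hx hy
  have e : lam • (z - x) - lam • (w - y) = lam • ((z - w) - (x - y)) := by module
  rw [e, inner_smul_left, inner_sub_left, real_inner_self_eq_norm_sq] at h
  simp only [conj_trivial] at h
  have h1 := nonneg_of_mul_nonneg_right h hlam
  have h2 := real_inner_le_norm (z - w) (x - y)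
  by_contra hc
  push Not at hc
  nlinarith [norm_nonneg (z - w), norm_nonneg (x - y)]

section ODE
variable {E : Type*} [NormedAddCommGroup E] [NormedSpace ℝ E]

lemma weighted_bound {k : ℝ → ℝ} (hk : LocallyIntegrable k volume) (hk0 : ∀ t, 0 ≤ k t)
    {g : ℝ → E} {C t : ℝ} (hC : 0 ≤ C) (ht : 0 ≤ t)
    (hg : ∀ s ∈ Icc 0 t, ‖g s‖ ≤ C * (k s * Real.exp (2 * ∫ r in (0:ℝ)..s, k r))) :
    ‖∫ s in (0:ℝ)..t, g s‖ ≤ C * Real.exp (2 * ∫ r in (0:ℝ)..t, k r) / 2 := by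
  have hKc : Continuous fun s => ∫ r in (0:ℝ)..s, k r :=
    intervalIntegral.continuous_primitive (fun a b => locInt_ii hk a b) 0
  have hi : IntervalIntegrable (fun s => C * (k s * Real.exp (2 * ∫ r in (0:ℝ)..s, k r)))
      volume 0 t :=
    ((locInt_ii hk 0 t).mul_continuousOn (by fun_prop)).const_mul C
  have h1 := intervalIntegral.norm_integral_le_of_norm_le (f := g) ht
    (Eventually.of_forall fun s hs => hg s ⟨hs.1.le, hs.2⟩) hi
  rw [intervalIntegral.integral_const_mul, integral_exp_weight hk hk0 ht] at h1
  nlinarith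

lemma ode_exists [CompleteSpace E] {k : ℝ → ℝ} (hk : LocallyIntegrable k volume)
    (hk0 : ∀ t, 0 ≤ k t) {F : ℝ → E → E} {M : ℝ} (hM : 0 ≤ M)
    (hFi : ∀ z : ℝ → E, Continuous z → LocallyIntegrable (fun s => F s (z s)) volume)
    (hL : ∀ s a b, ‖F s a - F s b‖ ≤ k s * ‖a - b‖) (hF0 : ∀ s, ‖F s 0‖ ≤ M * k s) (z0 : E) :
    ∃ z : ℝ → E, Continuous z ∧ ∀ t, 0 ≤ t → z t = z0 + ∫ s in (0:ℝ)..t, F s (z s) := by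
  set K : ℝ → ℝ := fun s => ∫ r in (0:ℝ)..s, k r with hK
  have hKc : Continuous K :=
    intervalIntegral.continuous_primitive (fun a b => locInt_ii hk a b) 0
  have hKnn : ∀ s, 0 ≤ s → 0 ≤ K s := fun s hs =>
    intervalIntegral.integral_nonneg hs fun _ _ => hk0 _
  set u : BoundedContinuousFunction ℝ E → ℝ → E := fun w s => Real.exp (2 * K s) • w s with hu
  have huc : ∀ w, Continuous (u w) := fun w => by
    simp only [hu]; fun_prop
  set T0 : BoundedContinuousFunction ℝ E → ℝ → E := fun w t =>
    Real.exp (-(2 * K (max t 0))) • (z0 + ∫ s in (0:ℝ)..(max t 0), F s (u w s)) with hT0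
  have hT0c : ∀ w, Continuous (T0 w) := fun w => by
    have h1 : Continuous fun t => ∫ s in (0:ℝ)..t, F s (u w s) :=
      intervalIntegral.continuous_primitive (fun a b => locInt_ii (hFi _ (huc w)) a b) 0
    have h2 : Continuous fun t : ℝ => ∫ s in (0:ℝ)..(max t 0), F s (u w s) :=
      h1.comp (by fun_prop : Continuous fun t : ℝ => max t 0)
    simp only [hT0]
    fun_prop
  have hT0b : ∀ w t, ‖T0 w t‖ ≤ ‖z0‖ + (M + ‖w‖) / 2 := by
    intro w t
    set r := max t 0 with hr
    have hr0 : 0 ≤ r := le_max_right _ _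
    have h1 := weighted_bound hk hk0 (g := fun s => F s (u w s)) (C := M + ‖w‖)
      (by positivity) hr0 (by
        intro s hs
        have h2 := hL s (u w s) 0
        have h3 : ‖F s (u w s)‖ ≤ ‖F s (u w s) - F s 0‖ + ‖F s 0‖ := by
          simpa using norm_add_le (F s (u w s) - F s 0) (F s 0)
        have h4 : ‖u w s‖ ≤ Real.exp (2 * K s) * ‖w‖ := by
          simp only [hu, norm_smul, Real.norm_eq_abs, Real.abs_exp]
          gcongr; exact w.norm_coe_le_norm s
        have h5 : 1 ≤ Real.exp (2 * K s) := Real.one_le_exp (by have := hKnn s hs.1; linarith)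
        rw [sub_zero] at h2
        calc ‖F s (u w s)‖ ≤ k s * (Real.exp (2 * K s) * ‖w‖) + M * k s * 1 := by
              have := hF0 s
              have := mul_le_mul_of_nonneg_left h4 (hk0 s)
              linarith
          _ ≤ k s * (Real.exp (2 * K s) * ‖w‖) + M * k s * Real.exp (2 * K s) := by
              have := hk0 s
              gcongr
          _ = _ := by ring)
    have hexp : Real.exp (-(2 * K r)) * Real.exp (2 * K r) = 1 := by
      rw [← Real.exp_add]; simp
    have hexp1 : Real.exp (-(2 * K r)) ≤ 1 :=
      Real.exp_le_one_iff.2 (by have := hKnn r hr0; linarith)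
    simp only [hT0, norm_smul, Real.norm_eq_abs, Real.abs_exp]
    calc _ ≤ Real.exp (-(2 * K r)) * (‖z0‖ + (M + ‖w‖) * Real.exp (2 * K r) / 2) := by
          gcongr
          exact (norm_add_le _ _).trans (by gcongr)
      _ = Real.exp (-(2 * K r)) * ‖z0‖
          + (Real.exp (-(2 * K r)) * Real.exp (2 * K r)) * ((M + ‖w‖) / 2) := by ring
      _ ≤ _ := by
          rw [hexp, one_mul]
          gcongr
          exact mul_le_of_le_one_left (norm_nonneg _) hexp1
  set T : BoundedContinuousFunction ℝ E → BoundedContinuousFunction ℝ E := fun w =>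
    BoundedContinuousFunction.ofNormedAddCommGroup (T0 w) (hT0c w) _ (hT0b w) with hT
  have hcon : ContractingWith (1/2) T := by
    refine ⟨by rw [← NNReal.coe_lt_coe]; norm_num, LipschitzWith.of_dist_le_mul fun w w' => ?_⟩
    rw [BoundedContinuousFunction.dist_le (by positivity)]
    intro t
    change dist (T0 w t) (T0 w' t) ≤ _
    set r := max t 0 with hr
    have hr0 : 0 ≤ r := le_max_right _ _
    have h1 := weighted_bound hk hk0 (g := fun s => F s (u w s) - F s (u w' s)) (C := dist w w')
      (by positivity) hr0 (by
        intro s hs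
        refine (hL s _ _).trans ?_
        have h4 : ‖u w s - u w' s‖ ≤ Real.exp (2 * K s) * dist w w' := by
          simp only [hu, ← smul_sub, norm_smul, Real.norm_eq_abs, Real.abs_exp]
          gcongr; rw [← dist_eq_norm]; exact BoundedContinuousFunction.dist_coe_le_dist s
        have := mul_le_mul_of_nonneg_left h4 (hk0 s)
        calc _ ≤ _ := this
          _ = _ := by ring)
    have hexp : Real.exp (-(2 * K r)) * Real.exp (2 * K r) = 1 := by
      rw [← Real.exp_add]; simp
    rw [dist_eq_norm]
    simp only [hT0]
    rw [← smul_sub, add_sub_add_left_eq_sub, ← intervalIntegral.integral_sub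
      (locInt_ii (hFi _ (huc w)) _ _) (locInt_ii (hFi _ (huc w')) _ _), norm_smul,
      Real.norm_eq_abs, Real.abs_exp]
    calc _ ≤ Real.exp (-(2 * K r)) * (dist w w' * Real.exp (2 * K r) / 2) := by
          gcongr
      _ = (Real.exp (-(2 * K r)) * Real.exp (2 * K r)) * (dist w w' / 2) := by ring
      _ = _ := by rw [hexp]; push_cast; ring
  set w := ContractingWith.fixedPoint T hcon with hw
  have hfix : T w = w := ContractingWith.fixedPoint_isFixedPt hcon
  refine ⟨u w, huc w, fun t ht => ?_⟩
  have h1 : T0 w t = w t := by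
    have := congrArg (fun g : BoundedContinuousFunction ℝ E => g t) hfix
    exact this
  change Real.exp (2 * K t) • w t = _
  rw [← h1]
  simp only [hT0, max_eq_left ht]
  rw [smul_smul, ← Real.exp_add]
  simp

lemma ode_unique {k : ℝ → ℝ} (hk : LocallyIntegrable k volume)
    (hk0 : ∀ t, 0 ≤ k t) {F : ℝ → E → E}
    (hL : ∀ s a b, ‖F s a - F s b‖ ≤ k s * ‖a - b‖) {z0 : E} {z w : ℝ → E}
    (hzc : ContinuousOn z (Ici 0)) (hwc : ContinuousOn w (Ici 0))
    (hzi : ∀ t, 0 ≤ t → IntervalIntegrable (fun s => F s (z s)) volume 0 t)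
    (hwi : ∀ t, 0 ≤ t → IntervalIntegrable (fun s => F s (w s)) volume 0 t)
    (hz : ∀ t, 0 ≤ t → z t = z0 + ∫ s in (0:ℝ)..t, F s (z s))
    (hw : ∀ t, 0 ≤ t → w t = z0 + ∫ s in (0:ℝ)..t, F s (w s)) {b : ℝ} (hb : 0 ≤ b) :
    z b = w b := by
  set K : ℝ → ℝ := fun s => ∫ r in (0:ℝ)..s, k r with hK
  have hKc : Continuous K :=
    intervalIntegral.continuous_primitive (fun a b => locInt_ii hk a b) 0
  have hc : ContinuousOn (fun t => Real.exp (-(2 * K t)) * ‖z t - w t‖) (Icc 0 b) := by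
    refine ContinuousOn.mul (by fun_prop) ?_
    exact ((hzc.sub hwc).norm).mono Icc_subset_Ici_self
  obtain ⟨t, ht, hmax⟩ := isCompact_Icc.exists_isMaxOn (nonempty_Icc.2 hb) hc
  set A := Real.exp (-(2 * K t)) * ‖z t - w t‖ with hA
  have hA0 : 0 ≤ A := by positivity
  have hle : ∀ s ∈ Icc 0 b, ‖z s - w s‖ ≤ A * Real.exp (2 * K s) := by
    intro s hs
    have h1 : Real.exp (-(2 * K s)) * ‖z s - w s‖ ≤ A := hmax hs
    have h2 := mul_le_mul_of_nonneg_right h1 (Real.exp_pos (2 * K s)).le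
    have hexp : Real.exp (-(2 * K s)) * Real.exp (2 * K s) = 1 := by
      rw [← Real.exp_add]; simp
    calc ‖z s - w s‖ = (Real.exp (-(2 * K s)) * Real.exp (2 * K s)) * ‖z s - w s‖ := by
          rw [hexp, one_mul]
      _ = Real.exp (-(2 * K s)) * ‖z s - w s‖ * Real.exp (2 * K s) := by ring
      _ ≤ _ := h2
  have h1 := weighted_bound hk hk0 (g := fun s => F s (z s) - F s (w s)) hA0 ht.1 (by
    intro s hs
    refine (hL s _ _).trans ?_
    have := mul_le_mul_of_nonneg_left (hle s ⟨hs.1, hs.2.trans ht.2⟩) (hk0 s)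
    calc _ ≤ _ := this
      _ = _ := by ring)
  rw [intervalIntegral.integral_sub (hzi t ht.1) (hwi t ht.1),
    ← add_sub_add_left_eq_sub _ _ z0, ← hz t ht.1, ← hw t ht.1] at h1
  have h2 := mul_le_mul_of_nonneg_left h1 (Real.exp_pos (-(2 * K t))).le
  have hexp : Real.exp (-(2 * K t)) * Real.exp (2 * K t) = 1 := by
    rw [← Real.exp_add]; simp
  have h3 : A ≤ A / 2 := by
    calc A ≤ _ := h2
      _ = (Real.exp (-(2 * K t)) * Real.exp (2 * K t)) * (A / 2) := by ring
      _ = _ := by rw [hexp, one_mul]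
  have h4 : A = 0 := by linarith
  have h5 := hle b ⟨hb, le_rfl⟩
  rw [h4, zero_mul] at h5
  exact sub_eq_zero.1 (norm_le_zero_iff.1 h5)

end ODE

/-- Existence and uniqueness of a strong global solution of the Cauchy
problem for the Tikhonov-regularized Newton dynamic. -/
theorem stmt0 (Φ : H → EReal) (hproper : ProperFn Φ) (hconv : EConvexOn Φ)
    (hlsc : LowerSemicontinuous Φ)
    (lam : ℝ) (hlam : 0 < lam)
    (ε : ℝ → ℝ) (hεnn : ∀ t, 0 ≤ ε t)
    (hεint : ∀ b : ℝ, 0 < b → IntervalIntegrable ε volume 0 b)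
    (x₀ v₀ : H) (h₀ : v₀ ∈ subdiff Φ x₀) :
    ∃ x v : ℝ → H,
      (IsStrongSol Φ lam ε x v ∧ x 0 = x₀ ∧ v 0 = v₀) ∧
      ∀ x₁ v₁ : ℝ → H, (IsStrongSol Φ lam ε x₁ v₁ ∧ x₁ 0 = x₀ ∧ v₁ 0 = v₀) →
        ∀ t : ℝ, 0 ≤ t → x₁ t = x t ∧ v₁ t = v t := by
  classical
  choose J hJ using prox_exists hproper hconv hlsc hlam h₀
  have hJ1 : ∀ z w, ‖J z - J w‖ ≤ ‖z - w‖ := fun z w => prox_nonexp hproper hlam (hJ z) (hJ w)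
  have hJu : ∀ z x, lam • (z - x) ∈ subdiff Φ x → x = J z := by
    intro z x hx
    have := prox_nonexp hproper hlam hx (hJ z)
    rw [sub_self, norm_zero] at this
    exact sub_eq_zero.1 (norm_le_zero_iff.1 this)
  have hJc : Continuous J := by
    have : LipschitzWith 1 J := LipschitzWith.of_dist_le_mul fun z w => by
      simpa [dist_eq_norm] using hJ1 z w
    exact this.continuous
  set e : ℝ → ℝ := indicator (Ioi 0) ε with he
  have he0 : ∀ t, 0 ≤ e t := fun t => indicator_nonneg (fun s _ => hεnn s) t
  have heε : ∀ t, 0 < t → e t = ε t := fun t ht => indicator_of_mem (mem_Ioi.2 ht) _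
  have hel : LocallyIntegrable e volume := by
    intro x
    refine ⟨Ioo (x - 1) (x + 1), Ioo_mem_nhds (by linarith) (by linarith), ?_⟩
    rw [IntegrableOn, he, integrable_indicator_iff measurableSet_Ioi, IntegrableOn,
      Measure.restrict_restrict measurableSet_Ioi]
    have h1 := (hεint (|x| + 1) (by positivity)).1
    refine h1.mono_set ?_
    rintro s ⟨hs1, hs2⟩
    exact ⟨hs1, by have := le_abs_self x; linarith [hs2.2]⟩
  set F : ℝ → H → H := fun s a => -(a - J a) - (lam⁻¹ * e s) • J a with hF
  set k : ℝ → ℝ := fun s => 2 + lam⁻¹ * e s with hk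
  have hlam' : 0 < lam⁻¹ := inv_pos.2 hlam
  have hkl : LocallyIntegrable k volume :=
    (locallyIntegrable_const 2).add (hel.smul lam⁻¹)
  have hk0 : ∀ t, 0 ≤ k t := fun t => by
    have := mul_nonneg hlam'.le (he0 t)
    simp only [hk]; linarith
  have hL : ∀ s a b, ‖F s a - F s b‖ ≤ k s * ‖a - b‖ := by
    intro s a b
    have h0 := mul_nonneg hlam'.le (he0 s)
    have e1 : F s a - F s b = -(a - b) + (J a - J b) - (lam⁻¹ * e s) • (J a - J b) := by
      simp only [hF]; module
    rw [e1]
    refine (norm_sub_le _ _).trans ?_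
    have h2 := norm_add_le (-(a - b)) (J a - J b)
    rw [norm_neg] at h2
    rw [norm_smul, Real.norm_of_nonneg h0]
    have h3 := hJ1 a b
    have h4 := mul_le_mul_of_nonneg_left h3 h0
    simp only [hk]
    linarith
  have hF0 : ∀ s, ‖F s 0‖ ≤ ‖J 0‖ * k s := by
    intro s
    have h0 := mul_nonneg hlam'.le (he0 s)
    have e1 : F s 0 = J 0 - (lam⁻¹ * e s) • J 0 := by simp [hF]
    rw [e1]
    refine (norm_sub_le _ _).trans ?_
    rw [norm_smul, Real.norm_of_nonneg h0]
    simp only [hk]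
    nlinarith [norm_nonneg (J 0)]
  have hFi : ∀ z : ℝ → H, Continuous z → LocallyIntegrable (fun s => F s (z s)) volume := by
    intro z hz
    have h1 : LocallyIntegrable (fun s => -(z s - J (z s))) volume :=
      Continuous.locallyIntegrable (by fun_prop)
    have h2 : LocallyIntegrable (fun s => (lam⁻¹ * e s) • J (z s)) volume := by
      have h3 : LocallyIntegrable (fun s => lam⁻¹ * e s) volume := hel.smul lam⁻¹
      have h4 := h3.locallyIntegrableOn univ
      rw [← locallyIntegrableOn_univ]
      exact h4.smul_continuousOn isClosed_univ.isLocallyClosed (by fun_prop)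
    exact h1.sub h2
  obtain ⟨y, hyc, hy⟩ := ode_exists hkl hk0 (norm_nonneg (J 0)) hFi hL hF0 (x₀ + lam⁻¹ • v₀)
  set g : ℝ → H := fun s => F s (y s) with hg
  have hgl : LocallyIntegrable g volume := hFi y hyc
  set z : ℝ → H := fun t => (x₀ + lam⁻¹ • v₀) + ∫ s in (0:ℝ)..t, g s with hz
  have hzc : Continuous z := continuous_const.add
    (intervalIntegral.continuous_primitive (fun a b => locInt_ii hgl a b) 0)
  have hyz : ∀ t, 0 ≤ t → y t = z t := hy
  have hz0 : z 0 = x₀ + lam⁻¹ • v₀ := by simp [hz]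
  have hJ0 : J (z 0) = x₀ := by
    symm
    apply hJu
    rw [hz0, add_sub_cancel_left, smul_smul, mul_inv_cancel₀ hlam.ne', one_smul]
    exact h₀
  obtain ⟨x', hx'l, hx'⟩ := rnp (f := fun t => J (z t)) (h := fun t => ‖g t‖)
    (hJc.comp hzc) (fun r => (hgl r).norm) (fun _ => norm_nonneg _) (by
      intro s t hst
      refine (hJ1 _ _).trans ?_
      simp only [hz]
      rw [add_sub_add_left_eq_sub, intervalIntegral.integral_interval_sub_left
        (locInt_ii hgl _ _) (locInt_ii hgl _ _)]
      exact intervalIntegral.norm_integral_le_integral_norm hst)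
  refine ⟨fun t => J (z t), fun t => lam • (z t - J (z t)), ⟨⟨x', fun t => lam • (g t - x' t),
    ?_, ?_, ?_, ?_, ?_⟩, hJ0, ?_⟩, ?_⟩
  · intro b _
    exact ⟨locInt_ii hx'l _ _, ((locInt_ii hgl _ _).sub (locInt_ii hx'l _ _)).smul lam⟩
  · intro t _
    exact hx' 0 t
  · intro t _
    beta_reduce
    rw [intervalIntegral.integral_smul, intervalIntegral.integral_sub (locInt_ii hgl _ _)
      (locInt_ii hx'l _ _), hx' 0 t, hz0]
    simp only [hz]
    module
  · intro t _
    exact hJ _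
  · have hne : ∀ᵐ t ∂(volume.restrict (Ici (0:ℝ))), t ≠ 0 :=
      ae_restrict_of_ae (by simp [ae_iff, measure_singleton])
    filter_upwards [hne, ae_restrict_mem measurableSet_Ici] with t ht0 ht
    have ht' : 0 < t := lt_of_le_of_ne ht (Ne.symm ht0)
    simp only [hg, hF]
    rw [hyz t ht, heε t ht']
    have : lam • ((lam⁻¹ * ε t) • J (z t)) = ε t • J (z t) := by
      rw [smul_smul, mul_inv_cancel_left₀ hlam.ne']
    rw [smul_sub, smul_sub lam (-(z t - J (z t))), this]
    module
  · beta_reduce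
    rw [hJ0, hz0, add_sub_cancel_left, smul_smul, mul_inv_cancel₀ hlam.ne', one_smul]
  · rintro x₁ v₁ ⟨⟨a', b', hIntg, hxa, hvb, hsub, hae⟩, hx0, hv0⟩
    set w : ℝ → H := fun t => x₁ t + lam⁻¹ • v₁ t with hw
    have hxw : ∀ t, 0 ≤ t → x₁ t = J (w t) := by
      intro t ht
      apply hJu
      simp only [hw]
      rw [add_sub_cancel_left, smul_smul, mul_inv_cancel₀ hlam.ne', one_smul]
      exact hsub t ht
    have hii : ∀ t, 0 ≤ t → IntervalIntegrable a' volume 0 t ∧ IntervalIntegrable b' volume 0 t := by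
      intro t ht
      have := hIntg (t + 1) (by linarith)
      have hs : uIcc 0 t ⊆ uIcc 0 (t + 1) := by
        rw [uIcc_of_le ht, uIcc_of_le (by linarith)]
        exact Icc_subset_Icc_right (by linarith)
      exact ⟨this.1.mono_set hs, this.2.mono_set hs⟩
    have hae' : ∀ᵐ t, 0 < t → a' t + lam⁻¹ • b' t = F t (w t) := by
      rw [ae_restrict_iff' measurableSet_Ici] at hae
      filter_upwards [hae] with t ht ht0
      have h1 := ht ht0.le
      simp only [hF]
      rw [← hxw t ht0.le, heε t ht0]
      simp only [hw]
      have h2 : lam⁻¹ • (lam • a' t + b' t + v₁ t + ε t • x₁ t) = 0 := by rw [h1, smul_zero]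
      rw [smul_add, smul_add, smul_add, smul_smul, inv_mul_cancel₀ hlam.ne', one_smul,
        smul_smul] at h2
      rw [← sub_eq_zero, ← h2]
      module
    have hFw : ∀ t, 0 ≤ t → IntervalIntegrable (fun s => F s (w s)) volume 0 t := by
      intro t ht
      refine ((hii t ht).1.add ((hii t ht).2.smul lam⁻¹)).congr_ae ?_
      rw [EventuallyEq, ae_restrict_iff' measurableSet_uIoc]
      filter_upwards [hae'] with s hs hs'
      rw [uIoc_of_le ht] at hs'
      exact hs hs'.1
    have hwe : ∀ t, 0 ≤ t → w t = (x₀ + lam⁻¹ • v₀) + ∫ s in (0:ℝ)..t, F s (w s) := by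
      intro t ht
      have h1 : ∫ s in (0:ℝ)..t, F s (w s) = ∫ s in (0:ℝ)..t, (a' s + lam⁻¹ • b' s) := by
        apply intervalIntegral.integral_congr_ae
        filter_upwards [hae'] with s hs hs'
        rw [uIoc_of_le ht] at hs'
        exact (hs hs'.1).symm
      have h2 : ∫ s in (0:ℝ)..t, (a' s + lam⁻¹ • b' s)
          = (∫ s in (0:ℝ)..t, a' s) + ∫ s in (0:ℝ)..t, lam⁻¹ • b' s :=
        intervalIntegral.integral_add (hii t ht).1 ((hii t ht).2.smul lam⁻¹)
      rw [h1, h2, intervalIntegral.integral_smul]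
      simp only [hw]
      rw [hxa t ht, hvb t ht, hx0, hv0]
      module
    have hwc : ContinuousOn w (Ici 0) := by
      intro t ht
      have h1 : ContinuousOn w (Icc 0 (t + 1)) := by
        have h2 : ContinuousOn (fun r => ∫ s in (0:ℝ)..r, F s (w s)) (uIcc 0 (t + 1)) :=
          intervalIntegral.continuousOn_primitive_interval'
            (hFw (t + 1) (by linarith [mem_Ici.1 ht])) (by simp)
        rw [uIcc_of_le (by linarith [mem_Ici.1 ht])] at h2
        exact (continuousOn_const.add h2).congr fun r hr => hwe r hr.1
      refine (h1 t ⟨ht, by linarith⟩).mono_of_mem_nhdsWithin ?_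
      rw [← Ici_inter_Iic]
      exact inter_mem self_mem_nhdsWithin
        (mem_nhdsWithin_of_mem_nhds (Iic_mem_nhds (by linarith)))
    intro t ht
    have hwz : w t = z t := by
      rw [← hyz t ht]
      exact ode_unique hkl hk0 hL hwc hyc.continuousOn hFw
        (fun t _ => locInt_ii hgl _ _) hwe hy ht
    refine ⟨by rw [hxw t ht, hwz], ?_⟩
    beta_reduce
    rw [← hwz, ← hxw t ht]
    simp only [hw]
    rw [add_sub_cancel_left, smul_smul, mul_inv_cancel₀ hlam.ne', one_smul]
end
end

section
/- Let Φ : H → [0,+∞] be a proper, closed, convex function on a real Hilbert space H such that C = argmin Φ = Φ^{−1}(0) is nonempty, let λ > 0 and μ = 1/λ. Assume: (H1)ε: for every p in the range of the normal cone map N_C, ∫₀^{+∞} [μ Φ*(ε(t)p/μ) − σ_C(ε(t)p) + (1/2)‖ε(t)p‖²] dt < +∞; and (H2)ε: ε(·) is a nonincreasing function of class C¹, Lipschitz continuous on [0,+∞), with lim_{t→+∞} ε(t) = 0, ∫₀^{+∞} ε(t) dt = +∞, and −k ε² ≤ ε̇ for some k ≥ 0. Then for any strong global solution (x(·), v(·))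 of the system v(t) ∈ ∂Φ(x(t)), λẋ(t) + v̇(t) + v(t) + ε(t)x(t) = 0, setting y(t) = x(t) + μ v(t), the trajectory y(t) converges weakly, as t → +∞, to proj_{argmin Φ}(0), the projection of the origin onto the closed convex set argmin Φ (i.e., the element of minimal norm of argmin Φ). -/
noncomputable section
open MeasureTheory Filter Set
open scoped InnerProductSpace RealInnerProductSpace Topology ENNReal

variable {H : Type*} [NormedAddCommGroup H] [InnerProductSpace ℝ H] [CompleteSpace H]

theorem aux_minnorm (S : Set H) (hne : S.Nonempty) (hcl : IsClosed S) (hcv : Convex ℝ S) :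
    ∃ z ∈ S, (∀ w ∈ S, ‖w - z‖ ^ 2 ≤ ‖w‖ ^ 2 - ‖z‖ ^ 2) := by
  obtain ⟨z, hz, hmin⟩ := exists_norm_eq_iInf_of_complete_convex hne hcl.isComplete hcv (0 : H)
  refine ⟨z, hz, fun w hw => ?_⟩
  have h := (norm_eq_iInf_iff_real_inner_le_zero hcv hz).1 hmin w hw
  have h1 : ‖w‖ ^ 2 = ‖(w - z) + z‖ ^ 2 := by simp
  rw [norm_add_sq_real] at h1
  rw [zero_sub, inner_neg_left, real_inner_comm] at h
  linarith

theorem aux_closed (Φ : H → EReal) (hlsc : LowerSemicontinuous Φ) (d : EReal) :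
    IsClosed {x : H | Φ x ≤ d} := hlsc.isClosed_preimage d

theorem aux_convex (Φ : H → EReal) (hconv : EConvexOn Φ) (d : ℝ) :
    Convex ℝ {x : H | Φ x ≤ (d : EReal)} := by
  intro x hx y hy a b ha hb hab
  refine (hconv x y a b ha hb hab).trans ?_
  have h1 : (a : EReal) * Φ x ≤ (a : EReal) * (d : EReal) :=
    mul_le_mul_of_nonneg_left hx (by exact_mod_cast ha)
  have h2 : (b : EReal) * Φ y ≤ (b : EReal) * (d : EReal) :=
    mul_le_mul_of_nonneg_left hy (by exact_mod_cast hb)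
  refine (add_le_add h1 h2).trans (le_of_eq ?_)
  have : a * d + b * d = d := by rw [← add_mul, hab, one_mul]
  exact_mod_cast this

theorem aux_sublevel (Φ : H → EReal) (hconv : EConvexOn Φ)
    (hlsc : LowerSemicontinuous Φ) (hnn : ∀ x, 0 ≤ Φ x) (p : H) (hp : Φ p = 0)
    (hmin : ∀ c, Φ c = 0 → ‖p‖ ≤ ‖c‖) (ρ : ℝ) (hρ : ρ < ‖p‖ ^ 2) :
    ∃ δ > (0 : ℝ), ∀ x, Φ x ≤ (δ : EReal) → ρ < ‖x‖ ^ 2 := by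
  by_contra! hcon
  set d : ℕ → ℝ := fun n => 1 / ((n : ℝ) + 1) with hd
  have hdpos : ∀ n, 0 < d n := fun n => by positivity
  have hdanti : Antitone d := fun n m h => by
    simp only [hd]
    have : (n : ℝ) ≤ m := by exact_mod_cast h
    gcongr
  have hdlim : Tendsto d atTop (𝓝 0) := tendsto_one_div_add_atTop_nhds_zero_nat
  have hex : ∀ n, ∃ z ∈ {x : H | Φ x ≤ (d n : EReal)},
      ∀ w ∈ {x : H | Φ x ≤ (d n : EReal)}, ‖w - z‖ ^ 2 ≤ ‖w‖ ^ 2 - ‖z‖ ^ 2 := fun n =>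
    aux_minnorm _ ⟨p, by
      change Φ p ≤ _; rw [hp]; exact_mod_cast (hdpos n).le⟩
      (aux_closed Φ hlsc _) (aux_convex Φ hconv _)
  choose z hz hzmin using hex
  have hzz : ∀ n m, n ≤ m → ‖z m - z n‖ ^ 2 ≤ ‖z m‖ ^ 2 - ‖z n‖ ^ 2 := fun n m h =>
    hzmin n (z m) ((show Φ (z m) ≤ (d m : EReal) from hz m).trans (by exact_mod_cast hdanti h))
  have hmono : Monotone fun n => ‖z n‖ ^ 2 := fun n m h => by
    have := hzz n m h
    have h2 := sq_nonneg ‖z m - z n‖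
    simp only; linarith
  have hle : ∀ n, ‖z n‖ ^ 2 ≤ ρ := fun n => by
    obtain ⟨w, hw, hwρ⟩ := hcon (d n) (hdpos n)
    have := hzmin n w hw
    have h2 := sq_nonneg ‖w - z n‖
    linarith
  have hlim := tendsto_atTop_ciSup hmono ⟨ρ, by rintro _ ⟨n, rfl⟩; exact hle n⟩
  set L := ⨆ n, ‖z n‖ ^ 2
  have hleL : ∀ n, ‖z n‖ ^ 2 ≤ L := fun n => hmono.ge_of_tendsto hlim n
  have hcau : CauchySeq z := by
    rw [Metric.cauchySeq_iff']
    intro e he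
    have : ∀ᶠ n in atTop, L - e ^ 2 < ‖z n‖ ^ 2 :=
      hlim.eventually (lt_mem_nhds (by have := pow_pos he 2; linarith))
    obtain ⟨N, hN⟩ := this.exists
    refine ⟨N, fun n hn => ?_⟩
    rw [dist_eq_norm]
    have h1 := hzz N n hn
    have h2 := hleL n
    exact lt_of_pow_lt_pow_left₀ 2 he.le (by linarith)
  obtain ⟨w, hw⟩ := cauchySeq_tendsto_of_complete hcau
  have hwn : ∀ n, Φ w ≤ (d n : EReal) := fun n =>
    (aux_closed Φ hlsc (d n : EReal)).mem_of_tendsto hw (by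
      filter_upwards [eventually_ge_atTop n] with m hm
      exact le_trans (hz m) (by exact_mod_cast hdanti hm))
  have hw0 : Φ w ≤ 0 := by
    refine ge_of_tendsto' (x := atTop) (f := fun n => (d n : EReal)) ?_ hwn
    exact (continuous_coe_real_ereal.tendsto 0).comp hdlim
  have h1 := hmin w (le_antisymm hw0 (hnn w))
  have h2 : ‖w‖ ^ 2 ≤ ρ := le_of_tendsto' (hw.norm.pow 2) hle
  have h3 : ‖p‖ ^ 2 ≤ ‖w‖ ^ 2 := by gcongr
  linarith

theorem aux_penal (Φ : H → EReal) (hconv : EConvexOn Φ)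
    (hlsc : LowerSemicontinuous Φ) (hnn : ∀ x, 0 ≤ Φ x) (p : H) (hp : Φ p = 0)
    (hmin : ∀ c, Φ c = 0 → ‖p‖ ≤ ‖c‖) (η : ℝ) (hη : 0 < η) :
    ∃ e0 > (0 : ℝ), ∀ e, 0 ≤ e → e ≤ e0 → ∀ x : H, ∀ r : ℝ, Φ x ≤ (r : EReal) →
      e * (‖p‖ ^ 2 / 2 - η) ≤ r + e / 2 * ‖x‖ ^ 2 := by
  obtain ⟨δ, hδ, h⟩ := aux_sublevel Φ hconv hlsc hnn p hp hmin (‖p‖ ^ 2 - 2 * η) (by linarith)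
  refine ⟨δ / (‖p‖ ^ 2 / 2 + 1), by positivity, fun e he hee x r hr => ?_⟩
  have hr0 : 0 ≤ r := by exact_mod_cast (hnn x).trans hr
  rw [le_div_iff₀ (by positivity)] at hee
  by_cases hrd : r ≤ δ
  · have := h x (hr.trans (by exact_mod_cast hrd))
    nlinarith
  · push Not at hrd
    have : 0 ≤ e / 2 * ‖x‖ ^ 2 := by positivity
    nlinarith [mul_nonneg he hη.le]

theorem aux_pointwise (x v p : H) (e m η : ℝ) (he : 0 ≤ e) (hm : 0 < m) (hη : 0 < η)
    (hem : e * m ≤ 1) (hem2 : e * m * ‖p‖ ^ 2 / 2 ≤ η)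
    (hr : e * (‖p‖ ^ 2 / 2 - η) ≤ ⟪v, x - p⟫ + e / 2 * ‖x‖ ^ 2) :
    ⟪x + m • v - p, -(m • (v + e • x))⟫ ≤
      -(m * e) * (1 / 2 * ‖x + m • v - p‖ ^ 2 - 2 * η) := by
  have h0 : 0 ≤ ‖e • x + v‖ ^ 2 := sq_nonneg _
  have h1 : 0 ≤ ‖v‖ ^ 2 := sq_nonneg _
  have e1 : ‖e • x + v‖ ^ 2 = e ^ 2 * ‖x‖ ^ 2 + 2 * e * ⟪x, v⟫ + ‖v‖ ^ 2 := by
    rw [norm_add_sq_real, norm_smul, mul_pow, inner_smul_left, Real.norm_eq_abs, sq_abs]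
    simp; ring
  have e2 : ‖x + m • v - p‖ ^ 2 = ‖x‖ ^ 2 + m ^ 2 * ‖v‖ ^ 2 + ‖p‖ ^ 2 + 2 * m * ⟪x, v⟫
      - 2 * ⟪x, p⟫ - 2 * m * ⟪v, p⟫ := by
    rw [norm_sub_sq_real, norm_add_sq_real, norm_smul, mul_pow, inner_add_left, inner_smul_left,
      inner_smul_right, Real.norm_eq_abs, sq_abs]
    simp; ring
  have e3 : ⟪x + m • v - p, -(m • (v + e • x))⟫ = -m * (⟪x, v⟫ + e * ‖x‖ ^ 2 + m * ‖v‖ ^ 2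
      + m * e * ⟪x, v⟫ - ⟪v, p⟫ - e * ⟪x, p⟫) := by
    simp only [← real_inner_self_eq_norm_sq, inner_add_left, inner_add_right, inner_sub_left,
      inner_neg_right, inner_smul_left, inner_smul_right, RCLike.conj_to_real,
      real_inner_comm x v, real_inner_comm p v, real_inner_comm p x]
    ring
  have e4 : ⟪v, x - p⟫ = ⟪x, v⟫ - ⟪v, p⟫ := by rw [inner_sub_right, real_inner_comm]
  rw [e3, e2]
  rw [e4] at hr
  rw [e1] at h0
  generalize ‖x‖ ^ 2 = X at *
  generalize ‖v‖ ^ 2 = V at *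
  generalize ‖p‖ ^ 2 = P at *
  generalize ⟪x, v⟫ = a at *
  generalize ⟪x, p⟫ = b at *
  generalize ⟪v, p⟫ = c at *
  have k1 := mul_nonneg (sub_nonneg.2 hem) (sub_nonneg.2 hr)
  have k2 := mul_nonneg hm.le h0
  have k3 := mul_nonneg hm.le (mul_nonneg (sub_nonneg.2 hem) h1)
  have k4 := mul_nonneg he (sub_nonneg.2 hem2)
  have k5 := mul_nonneg (mul_nonneg he (mul_nonneg he hm.le)) hη.le
  have key : 0 ≤ (a + e * X + m * V + m * e * a - c - e * b)
      - e * (1 / 2 * (X + m ^ 2 * V + P + 2 * m * a - 2 * b - 2 * m * c) - 2 * η) := by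
    linarith
  have := mul_nonneg hm.le key
  linarith

theorem aux_div (e : ℝ → ℝ) (he : Continuous e) (hnn : ∀ t, 0 ≤ e t)
    (hdiv : ∫⁻ t in Set.Ioi (0:ℝ), ENNReal.ofReal (e t) = ⊤) :
    Tendsto (fun t => ∫ s in (0:ℝ)..t, e s) atTop atTop := by
  have hmono : Monotone fun t => ∫ s in (0:ℝ)..t, e s := by
    intro s t hst
    have h1 := intervalIntegral.integral_add_adjacent_intervals
      (he.intervalIntegrable (μ := volume) 0 s) (he.intervalIntegrable (μ := volume) s t)
    have h2 : 0 ≤ ∫ u in s..t, e u := intervalIntegral.integral_nonneg hst fun u _ => hnn u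
    simp only; linarith
  rcases tendsto_atTop_of_monotone hmono with h | ⟨l, hl⟩
  · exact h
  · exfalso
    have hint : IntegrableOn e (Ioi 0) := by
      refine integrableOn_Ioi_of_intervalIntegral_norm_tendsto l 0
        (l := atTop) (b := fun t => t) (fun t => ?_) tendsto_id ?_
      · exact (he.integrableOn_Icc (a := 0) (b := t)).mono_set Ioc_subset_Icc_self
      · simpa [abs_of_nonneg (hnn _)] using hl
    have := hint.lintegral_lt_top
    rw [hdiv] at this
    exact lt_irrefl _ this

theorem aux_gronwall (θ θ' e : ℝ → ℝ) (m : ℝ) (hm : 0 < m) (hθ : ∀ t, HasDerivAt θ (θ' t) t)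
    (he : Continuous e) (hnn : ∀ t, 0 ≤ e t)
    (hdiv : ∫⁻ t in Set.Ioi (0:ℝ), ENNReal.ofReal (e t) = ⊤)
    (h : ∀ η > 0, ∃ T, ∀ t ≥ T, θ' t ≤ -(m * e t) * (θ t - 2 * η)) (hpos : ∀ t, 0 ≤ θ t) :
    Tendsto θ atTop (𝓝 0) := by
  have hE : ∀ t, HasDerivAt (fun t => ∫ s in (0:ℝ)..t, e s) (e t) t := fun t =>
    intervalIntegral.integral_hasDerivAt_right (he.intervalIntegrable _ _)
      (he.stronglyMeasurableAtFilter _ _) he.continuousAt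
  have hElim := aux_div e he hnn hdiv
  set E := fun t => ∫ s in (0:ℝ)..t, e s
  have hexp : ∀ t, HasDerivAt (fun t => Real.exp (m * E t)) (Real.exp (m * E t) * (m * e t)) t :=
    fun t => ((hE t).const_mul m).exp
  rw [Metric.tendsto_atTop']
  intro r hr
  obtain ⟨T, hT⟩ := h (r / 4) (by positivity)
  have hF : ∀ t, HasDerivAt (fun t => (θ t - 2 * (r / 4)) * Real.exp (m * E t))
      (θ' t * Real.exp (m * E t) + (θ t - 2 * (r / 4)) * (Real.exp (m * E t) * (m * e t))) t :=
    fun t => ((hθ t).sub_const _).mul (hexp t)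
  have hanti : AntitoneOn (fun t => (θ t - 2 * (r / 4)) * Real.exp (m * E t)) (Ici T) := by
    refine antitoneOn_of_deriv_nonpos (convex_Ici T)
      (fun t _ => (hF t).continuousAt.continuousWithinAt)
      (fun t _ => (hF t).differentiableAt.differentiableWithinAt) (fun t ht => ?_)
    rw [(hF t).deriv]
    rw [interior_Ici] at ht
    have h1 := hT t (le_of_lt ht)
    have h2 := Real.exp_pos (m * E t)
    nlinarith
  have hlim : Tendsto (fun t => (θ T - 2 * (r / 4)) * Real.exp (m * E T)
      * Real.exp (-(m * E t))) atTop (𝓝 0) := by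
    have h1 : Tendsto (fun t => Real.exp (-(m * E t))) atTop (𝓝 0) :=
      Real.tendsto_exp_neg_atTop_nhds_zero.comp (hElim.const_mul_atTop hm)
    simpa using h1.const_mul ((θ T - 2 * (r / 4)) * Real.exp (m * E T))
  have hev := (hlim.eventually (gt_mem_nhds (show (0 : ℝ) < r / 4 by positivity))).and
    (eventually_ge_atTop T)
  obtain ⟨N, hN⟩ := eventually_atTop.1 hev
  refine ⟨N, fun t ht => ?_⟩
  obtain ⟨h1, h2⟩ := hN t ht.le
  have h3 := hanti (mem_Ici.2 le_rfl) (mem_Ici.2 h2) h2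
  simp only at h3
  have h4 := mul_le_mul_of_nonneg_right h3 (Real.exp_pos (-(m * E t))).le
  rw [mul_assoc, ← Real.exp_add, add_neg_cancel, Real.exp_zero, mul_one] at h4
  rw [Real.dist_eq, sub_zero, abs_of_nonneg (hpos t)]
  linarith

theorem aux_cont (x x' : ℝ → H) (hint : ∀ b : ℝ, 0 < b → IntervalIntegrable x' volume 0 b)
    (hx : ∀ t : ℝ, 0 ≤ t → x t = x 0 + ∫ s in (0:ℝ)..t, x' s) :
    ContinuousOn x (Ici 0) := by
  intro t ht
  have ht0 : (0 : ℝ) ≤ t := ht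
  have hb : (0 : ℝ) < t + 1 := by linarith
  have h1 : ContinuousOn (fun t => x 0 + ∫ s in (0:ℝ)..t, x' s) (Icc 0 (t + 1)) := by
    refine continuousOn_const.add ?_
    have := intervalIntegral.continuousOn_primitive_interval (μ := volume) (f := x') (a := 0)
      (b := t + 1) (by rw [uIcc_of_le hb.le]; exact
        (intervalIntegrable_iff_integrableOn_Icc_of_le hb.le).1 (hint _ hb))
    rwa [uIcc_of_le hb.le] at this
  have h2 : ContinuousOn x (Icc 0 (t + 1)) := h1.congr fun s hs => hx s hs.1
  refine (h2 t ⟨ht0, by linarith⟩).mono_of_mem_nhdsWithin ?_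
  rw [← Ici_inter_Iic]
  exact inter_mem self_mem_nhdsWithin (mem_nhdsWithin_of_mem_nhds (Iic_mem_nhds (by linarith)))

/-- Under the slow-control hypotheses `(H1)_ε` and `(H2)_ε`, for any
strong global solution `(x, v)` of the regularized Newton dynamic, the trajectory
`y(t) = x(t) + μ v(t)` converges weakly to the projection of the origin onto
`argmin Φ` (the element of minimal norm of `argmin Φ`). -/
theorem stmt10 (Φ : H → EReal) (hproper : ProperFn Φ) (hconv : EConvexOn Φ)
    (hlsc : LowerSemicontinuous Φ) (hnn : ∀ x, 0 ≤ Φ x)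
    (C : Set H) (hC : C = {x : H | Φ x = 0}) (hCne : C.Nonempty)
    (lam μ : ℝ) (hlam : 0 < lam) (hμ : μ = 1 / lam)
    (ε ε' : ℝ → ℝ) (hεnn : ∀ t, 0 ≤ ε t)
    (H1 : ∀ p : H, (∃ x ∈ C, ∀ c ∈ C, ⟪p, c - x⟫ ≤ (0 : ℝ)) →
      ∫⁻ t in Set.Ioi (0:ℝ),
        eToENN ((μ : EReal) * fenchel Φ (μ⁻¹ • (ε t • p)) - suppFn C (ε t • p)
          + (((1 / 2) * ‖ε t • p‖ ^ 2 : ℝ) : EReal)) < ⊤)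
    (hεderiv : ∀ t ∈ Set.Ici (0:ℝ), HasDerivAt ε (ε' t) t)
    (hεC1 : ContinuousOn ε' (Set.Ici (0:ℝ)))
    (hεmono : AntitoneOn ε (Set.Ici (0:ℝ)))
    (hεlip : ∃ K : NNReal, LipschitzOnWith K ε (Set.Ici (0:ℝ)))
    (hεlim : Tendsto ε atTop (𝓝 0))
    (hεdiv : ∫⁻ t in Set.Ioi (0:ℝ), ENNReal.ofReal (ε t) = ⊤)
    (hεk : ∃ k : ℝ, 0 ≤ k ∧ ∀ t ∈ Set.Ici (0:ℝ), -k * (ε t) ^ 2 ≤ ε' t)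
    (x v : ℝ → H) (hsol : IsStrongSol Φ lam ε x v) :
    ∃ l : H, l ∈ C ∧ (∀ c ∈ C, ‖l‖ ≤ ‖c‖) ∧
      ∀ z : H, Tendsto (fun t : ℝ => (⟪x t + μ • v t, z⟫ : ℝ)) atTop (𝓝 (⟪l, z⟫ : ℝ)) := by
  obtain ⟨x', v', hint, hx, hv, hsub, hode⟩ := hsol
  have hμpos : 0 < μ := by rw [hμ]; positivity
  have hμl : μ * lam = 1 := by rw [hμ]; field_simp
  subst hC
  -- the minimal norm element
  have hC0 : {x : H | Φ x = 0} = {x : H | Φ x ≤ ((0 : ℝ) : EReal)} := by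
    ext w
    exact ⟨fun h => le_of_eq h, fun h => le_antisymm h (hnn w)⟩
  obtain ⟨p, hp, hpmin⟩ := aux_minnorm {x : H | Φ x = 0} hCne
    (by rw [hC0]; exact aux_closed Φ hlsc _) (by rw [hC0]; exact aux_convex Φ hconv _)
  have hp0 : Φ p = 0 := hp
  have hmin : ∀ c, Φ c = 0 → ‖p‖ ≤ ‖c‖ := fun c hc => by
    have h1 := hpmin c hc
    have h2 := sq_nonneg ‖c - p‖
    exact le_of_sq_le_sq (by linarith) (norm_nonneg _)
  refine ⟨p, hp, hmin, ?_⟩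
  have hxc := aux_cont x x' (fun b hb => (hint b hb).1) hx
  have hvc := aux_cont v v' (fun b hb => (hint b hb).2) hv
  have hεc : ContinuousOn ε (Ici 0) := fun t ht => (hεderiv t ht).continuousAt.continuousWithinAt
  have hmax : Continuous fun t : ℝ => max t 0 := by fun_prop
  have hmaxm : ∀ t : ℝ, max t 0 ∈ Ici (0 : ℝ) := fun t => mem_Ici.2 (le_max_right _ _)
  set X : ℝ → H := fun t => x (max t 0) with hX
  set V : ℝ → H := fun t => v (max t 0) with hV
  set e : ℝ → ℝ := fun t => ε (max t 0) with he
  have hXc : Continuous X := hxc.comp_continuous hmax hmaxm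
  have hVc : Continuous V := hvc.comp_continuous hmax hmaxm
  have hec : Continuous e := hεc.comp_continuous hmax hmaxm
  set G : ℝ → H := fun t => -(μ • (V t + e t • X t)) with hG
  have hGc : Continuous G := by fun_prop
  set Y : ℝ → H := fun t => (x 0 + μ • v 0) + ∫ s in (0:ℝ)..t, G s with hY
  have hYd : ∀ t, HasDerivAt Y (G t) t := fun t =>
    (intervalIntegral.integral_hasDerivAt_right (hGc.intervalIntegrable _ _)
      (hGc.stronglyMeasurableAtFilter _ _) hGc.continuousAt).const_add _
  have hYy : ∀ t, 0 ≤ t → Y t = x t + μ • v t := by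
    intro t ht
    rcases ht.eq_or_lt with rfl | ht'
    · simp [hY]
    obtain ⟨i1, i2⟩ := hint t ht'
    have hEq : ∫ s in (0:ℝ)..t, G s = ∫ s in (0:ℝ)..t, (x' s + μ • v' s) := by
      refine intervalIntegral.integral_congr_ae ?_
      rw [ae_restrict_iff' measurableSet_Ici] at hode
      filter_upwards [hode] with s hs hs'
      rw [uIoc_of_le ht] at hs'
      have hs0 : 0 ≤ s := hs'.1.le
      have h1 := hs hs0
      have h2 : V s + e s • X s = -(lam • x' s + v' s) := by
        simp only [hX, hV, he, max_eq_left hs0]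
        rw [eq_neg_iff_add_eq_zero, ← h1]; abel
      simp only [hG]
      rw [h2, smul_neg, neg_neg, smul_add, smul_smul, hμl, one_smul]
    have i3 : IntervalIntegrable (fun s => μ • v' s) volume 0 t := i2.smul μ
    rw [hx t ht, hv t ht]
    simp only [hY]
    rw [hEq, intervalIntegral.integral_add i1 i3, intervalIntegral.integral_smul,
      smul_add]
    abel
  have hθ : Tendsto (fun t => 1 / 2 * ‖Y t - p‖ ^ 2) atTop (𝓝 0) := by
    refine aux_gronwall _ (fun t => ⟪Y t - p, G t⟫) e μ hμpos (fun t => ?_) hec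
      (fun t => hεnn _) ?_ ?_ (fun t => by positivity)
    · have := (((hYd t).sub_const p).norm_sq).const_mul (1 / 2 : ℝ)
      rw [← mul_assoc, one_div, inv_mul_cancel₀ two_ne_zero, one_mul] at this
      rw [one_div]
      exact this
    · rw [← hεdiv]
      refine setLIntegral_congr_fun measurableSet_Ioi fun t ht => ?_
      simp only [he, max_eq_left (le_of_lt (mem_Ioi.1 ht))]
    · intro η hη
      obtain ⟨e0, he0, hpen⟩ := aux_penal Φ hconv hlsc hnn p hp0 hmin η hη
      have l1 : Tendsto (fun t => ε t * μ) atTop (𝓝 0) := by simpa using hεlim.mul_const μ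
      have l2 : Tendsto (fun t => ε t * μ * ‖p‖ ^ 2 / 2) atTop (𝓝 0) := by
        simpa using (l1.mul_const (‖p‖ ^ 2)).div_const 2
      have hev := (((hεlim.eventually (gt_mem_nhds he0)).and
        (l1.eventually (gt_mem_nhds one_pos))).and (l2.eventually (gt_mem_nhds hη))).and
        (eventually_ge_atTop (0 : ℝ))
      obtain ⟨T, hT⟩ := eventually_atTop.1 hev
      refine ⟨T, fun t ht => ?_⟩
      obtain ⟨⟨⟨a1, a2⟩, a3⟩, a4⟩ := hT t ht
      have hr : Φ (x t) ≤ ((⟪v t, x t - p⟫ : ℝ) : EReal) := by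
        have h1 := hsub t a4 p
        rw [hp0] at h1
        have h2 : (⟪v t, x t - p⟫ : ℝ) = -⟪v t, p - x t⟫ := by
          rw [← inner_neg_right, neg_sub]
        rw [h2]
        generalize (⟪v t, p - x t⟫ : ℝ) = q at h1
        have h3 := add_le_add_left h1 ((-q : ℝ) : EReal)
        rw [add_assoc, ← EReal.coe_add, add_neg_cancel, zero_add] at h3
        simpa using h3
      have := aux_pointwise (x t) (v t) p (ε t) μ η (hεnn t) hμpos hη a2.le a3.le
        (hpen (ε t) (hεnn t) a1.le (x t) _ hr)
      simp only [hG, hX, hV, he, max_eq_left a4, hYy t a4]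
      exact this
  have hstrong : Tendsto Y atTop (𝓝 p) := by
    rw [tendsto_iff_norm_sub_tendsto_zero]
    have h1 := (hθ.const_mul 2).sqrt
    simpa [← mul_assoc] using h1
  intro z
  have h1 : Tendsto (fun t => (⟪Y t, z⟫ : ℝ)) atTop (𝓝 ⟪p, z⟫) := hstrong.inner tendsto_const_nhds
  refine h1.congr' ?_
  filter_upwards [eventually_ge_atTop (0 : ℝ)] with t ht
  rw [hYy t ht]
end
end

section
/- Let Φ : H → [0,+∞] be a proper, closed, convex function on a real Hilbert space H such that C = argmin Φ = Φ^{−1}(0) is nonempty and Φ(0) < +∞, let λ > 0 and μ = 1/λ. Assume: (H1)ε: for every p in the range of the normal cone map N_C, ∫₀^{+∞} [μ Φ*(ε(t)p/μ) − σ_C(ε(t)p) + (1/2)‖ε(t)p‖²] dt < +∞; and (H2)ε: ε(·) is a nonincreasing C¹ function, Lipschitz continuous on [0,+∞), with lim_{t→+∞} ε(t) = 0, ∫₀^{+∞} ε(t) dt = +∞, and −k ε² ≤ ε̇ for some k ≥ 0. Then for any strong global solution (x(·), v(·)) of v(t) ∈ ∂Φ(x(t)), λẋ(t) + v̇(t)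 + v(t) + ε(t)x(t) = 0, with y(t) = x(t) + μ v(t): (ii) x(t) and y(t) both converge weakly, as t → +∞, to proj_{argmin Φ}(0); and (iii) v(t) converges strongly to 0, and hence x(t) − y(t) converges strongly to 0, as t → +∞. -/
noncomputable section
open MeasureTheory Filter Set
open scoped InnerProductSpace RealInnerProductSpace Topology ENNReal

variable {H : Type*} [NormedAddCommGroup H] [InnerProductSpace ℝ H] [CompleteSpace H]

/-- Scalar lemma: a nonnegative `h` with `h' + a ε h ≤ g`, `g` integrable, `∫ ε = ∞`, tends to 0. -/
lemma scalar_lim (h D ε : ℝ → ℝ) (a T : ℝ) (ha : 0 < a) (hT : 0 < T) (hnn : ∀ t, 0 ≤ h t)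
    (hεnn : ∀ t, 0 ≤ ε t) (hεc : ContinuousOn ε (Set.Ici 0))
    (hεdiv : ∫⁻ t in Set.Ioi (0:ℝ), ENNReal.ofReal (ε t) = ⊤)
    (hD : ∀ t, 0 < t → HasDerivAt h (D t) t) (hDc : ContinuousOn D (Set.Ioi 0))
    (G : ℝ → ℝ≥0∞) (hG : ∫⁻ t in Set.Ioi (0:ℝ), G t < ⊤)
    (hle : ∀ t, T ≤ t → ENNReal.ofReal (D t + a * (ε t * h t)) ≤ G t) :
    Tendsto h atTop (𝓝 0) := by
  set f : ℝ → ℝ := fun t => max (D t + a * (ε t * h t)) 0 with hf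
  have hεc' : ContinuousOn ε (Set.Ioi 0) := hεc.mono Ioi_subset_Ici_self
  have hhc : ContinuousOn h (Set.Ioi 0) := fun t ht => (hD t ht).continuousAt.continuousWithinAt
  have hfc : ContinuousOn f (Set.Ioi 0) :=
    (hDc.add (continuousOn_const.mul (hεc'.mul hhc))).sup continuousOn_const
  have hfnn : ∀ t, 0 ≤ f t := fun t => le_max_right _ _
  have hsub : ∀ s t : ℝ, T ≤ s → s ≤ t → Set.uIcc s t ⊆ Set.Ioi 0 := by
    intro s t hs hst
    rw [uIcc_of_le hst]
    intro r hr
    exact lt_of_lt_of_le hT (hs.trans hr.1)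
  have ii : ∀ (φ : ℝ → ℝ), ContinuousOn φ (Set.Ioi 0) → ∀ s t : ℝ, T ≤ s → s ≤ t →
      IntervalIntegrable φ volume s t := fun φ hφ s t hs hst =>
    (hφ.mono (hsub s t hs hst)).intervalIntegrable
  have hfint : IntegrableOn f (Set.Ioi T) := by
    refine ⟨(hfc.mono (Ioi_subset_Ioi hT.le)).aestronglyMeasurable measurableSet_Ioi, ?_⟩
    rw [hasFiniteIntegral_iff_ofReal (Eventually.of_forall hfnn)]
    refine lt_of_le_of_lt ?_ hG
    calc ∫⁻ t in Set.Ioi T, ENNReal.ofReal (f t) ≤ ∫⁻ t in Set.Ioi T, G t := by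
          refine setLIntegral_mono' measurableSet_Ioi ?_
          intro t ht
          have := hle t (le_of_lt ht)
          simpa [hf, ENNReal.ofReal_max] using this
      _ ≤ _ := lintegral_mono_set (Ioi_subset_Ioi hT.le)
  have hFTC : ∀ s t : ℝ, T ≤ s → s ≤ t → h t - h s = ∫ r in s..t, D r := by
    intro s t hs hst
    rw [intervalIntegral.integral_eq_sub_of_hasDerivAt]
    · intro r hr
      exact hD r (hsub s t hs hst hr)
    · exact ii D hDc s t hs hst
  -- the key inequality
  have key : ∀ s t : ℝ, T ≤ s → s ≤ t →
      h t - h s + ∫ r in s..t, a * (ε r * h r) ≤ ∫ r in s..t, f r := by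
    intro s t hs hst
    have i2 : IntervalIntegrable (fun r => a * (ε r * h r)) volume s t :=
      ii _ (continuousOn_const.mul (hεc'.mul hhc)) s t hs hst
    rw [hFTC s t hs hst, ← intervalIntegral.integral_add (ii D hDc s t hs hst) i2]
    exact intervalIntegral.integral_mono_on hst ((ii D hDc s t hs hst).add i2)
      (ii f hfc s t hs hst) (fun r _ => le_max_left _ _)
  set I := ∫ r in Set.Ioi T, f r
  have hFlim : Tendsto (fun t => ∫ r in T..t, f r) atTop (𝓝 I) :=
    intervalIntegral_tendsto_integral_Ioi T hfint tendsto_id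
  have hFle : ∀ s t : ℝ, T ≤ s → s ≤ t → ∫ r in s..t, f r ≤ I := by
    intro s t hs hst
    rw [intervalIntegral.integral_of_le hst]
    exact setIntegral_mono_set hfint (Eventually.of_forall hfnn)
      (LE.le.eventuallyLE (fun r hr => lt_of_le_of_lt hs hr.1))
  have hconv : ∃ m, Tendsto (fun t => h (max T t) - ∫ r in T..(max T t), f r) atTop (𝓝 m) := by
    have hanti : Antitone (fun t => h (max T t) - ∫ r in T..(max T t), f r) := by
      intro s t hst
      have h1 : T ≤ max T s := le_max_left _ _
      have h2 : max T s ≤ max T t := max_le_max_left _ hst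
      have := key _ _ h1 h2
      have h3 : 0 ≤ ∫ r in (max T s)..(max T t), a * (ε r * h r) :=
        intervalIntegral.integral_nonneg h2
          (fun r _ => mul_nonneg ha.le (mul_nonneg (hεnn r) (hnn r)))
      have h4 := intervalIntegral.integral_add_adjacent_intervals
        (ii f hfc T _ le_rfl h1) (ii f hfc _ _ h1 h2)
      show h (max T t) - _ ≤ h (max T s) - _
      linarith
    refine ⟨_, tendsto_atTop_ciInf hanti ⟨-I, ?_⟩⟩
    rintro _ ⟨t, rfl⟩
    have := hFle T (max T t) le_rfl (le_max_left _ _)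
    have := hnn (max T t)
    show -I ≤ h (max T t) - _
    linarith
  obtain ⟨m, hm⟩ := hconv
  have hlim : Tendsto h atTop (𝓝 (m + I)) := by
    have : Tendsto (fun t => h t - ∫ r in T..t, f r) atTop (𝓝 m) := by
      refine hm.congr' ?_
      filter_upwards [eventually_ge_atTop T] with t ht
      rw [max_eq_right ht]
    simpa using this.add hFlim
  set L := m + I with hL
  have hL0 : 0 ≤ L := ge_of_tendsto' hlim hnn
  rcases hL0.eq_or_lt with h0 | hpos
  · rwa [← h0] at hlim
  exfalso
  obtain ⟨S, hS⟩ := (((hlim.eventually (lt_mem_nhds (half_lt_self hpos))).and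
    (eventually_ge_atTop T))).exists_forall_of_atTop
  have hTS : T ≤ S := (hS S le_rfl).2
  have hS0 : 0 < S := hT.trans_le hTS
  have hb : ∀ t, S ≤ t → ∫ r in S..t, ε r ≤ (h S + I) / (a * (L / 2)) := by
    intro t ht
    rw [le_div_iff₀ (by positivity), mul_comm, ← intervalIntegral.integral_const_mul]
    have h1 := key S t hTS ht
    have h2 := hFle S t hTS ht
    have h3 := hnn t
    have h4 : ∫ r in S..t, a * (L / 2) * ε r ≤ ∫ r in S..t, a * (ε r * h r) := by
      refine intervalIntegral.integral_mono_on ht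
        (ii _ (continuousOn_const.mul hεc') S t hTS ht)
        (ii _ (continuousOn_const.mul (hεc'.mul hhc)) S t hTS ht) ?_
      intro r hr
      have := (hS r hr.1).1
      have := mul_le_mul_of_nonneg_left this.le (mul_nonneg ha.le (hεnn r))
      nlinarith
    linarith
  have hεint : IntegrableOn ε (Set.Ioi S) := by
    refine integrableOn_Ioi_of_intervalIntegral_norm_bounded (b := fun n : ℕ => (n:ℝ))
      (l := atTop) ((h S + I) / (a * (L / 2))) S ?_ tendsto_natCast_atTop_atTop ?_
    · intro n
      rcases le_total S n with hn | hn
      · exact (ii ε hεc' S n hTS hn).1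
      · rw [Ioc_eq_empty (not_lt.mpr hn)]; exact integrableOn_empty
    · filter_upwards [tendsto_natCast_atTop_atTop.eventually_ge_atTop S] with n hn
      simpa [abs_of_nonneg (hεnn _)] using hb n hn
  have hεint2 : IntegrableOn ε (Set.Ioi 0) := by
    rw [← Ioc_union_Ioi_eq_Ioi hS0.le]
    refine IntegrableOn.union ?_ hεint
    exact ((hεc.mono Icc_subset_Ici_self).integrableOn_Icc).mono_set Ioc_subset_Icc_self
  have := hεint2.2
  rw [hasFiniteIntegral_iff_ofReal (Eventually.of_forall hεnn), hεdiv] at this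
  exact lt_irrefl _ this

lemma cont_prim (x x' : ℝ → H) (hi : ∀ b : ℝ, 0 < b → IntervalIntegrable x' volume 0 b)
    (hx : ∀ t : ℝ, 0 ≤ t → x t = x 0 + ∫ s in (0:ℝ)..t, x' s) : ContinuousOn x (Set.Ici 0) := by
  intro t ht
  have ht : 0 ≤ t := ht
  have h1 := intervalIntegral.continuousOn_primitive_interval' (hi (t + 1) (by linarith))
    (a := 0) left_mem_uIcc
  rw [uIcc_of_le (by linarith)] at h1
  have h2 : ContinuousOn x (Set.Icc 0 (t + 1)) :=
    (continuousOn_const.add h1).congr (fun s hs => hx s hs.1)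
  refine (h2 t ⟨ht, by linarith⟩).mono_of_mem_nhdsWithin ?_
  rw [← Ici_inter_Iic]
  exact inter_mem self_mem_nhdsWithin (mem_nhdsWithin_of_mem_nhds (Iic_mem_nhds (by linarith)))

/-- The pointwise Fenchel-type bound. -/
lemma fenchel_bound (Φ : H → EReal) (μ : ℝ) (hμ : 0 < μ) (C : Set H) (l q x v : H) (φ : ℝ)
    (hφ : Φ x = φ) (hl : l ∈ C) (hq : ∀ c ∈ C, ⟪q, c - l⟫ ≤ (0:ℝ)) :
    ENNReal.ofReal (⟪q, x + μ • v - l⟫ - μ * φ - 1 / 2 * ‖μ • v‖ ^ 2) ≤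
      eToENN ((μ : EReal) * fenchel Φ (μ⁻¹ • q) - suppFn C q
          + (((1 / 2) * ‖q‖ ^ 2 : ℝ) : EReal)) := by
  have hs : suppFn C q = ((⟪q, l⟫ : ℝ) : EReal) := by
    apply le_antisymm
    · refine iSup₂_le fun c hc => ?_
      have := hq c hc
      rw [inner_sub_right] at this
      exact EReal.coe_le_coe_iff.mpr (by linarith)
    · exact le_iSup₂_of_le l hl le_rfl
  have hf : ((⟪x, μ⁻¹ • q⟫ - φ : ℝ) : EReal) ≤ fenchel Φ (μ⁻¹ • q) := by
    refine le_iSup_of_le x ?_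
    rw [hφ, EReal.coe_sub]
  rw [hs]
  generalize fenchel Φ (μ⁻¹ • q) = F at hf
  induction F with
  | bot => exact absurd (le_bot_iff.mp hf) (EReal.coe_ne_bot _)
  | top =>
    have : (μ : EReal) * ⊤ - ((⟪q, l⟫ : ℝ) : EReal) + (((1 / 2) * ‖q‖ ^ 2 : ℝ) : EReal) = ⊤ := by
      rw [EReal.coe_mul_top_of_pos hμ, EReal.top_sub_coe, EReal.top_add_coe]
    rw [this]
    simp [eToENN]
  | coe F =>
    have hf := EReal.coe_le_coe_iff.mp hf
    rw [← EReal.coe_mul, ← EReal.coe_sub, ← EReal.coe_add, eToENN,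
      if_neg (EReal.coe_ne_top _), EReal.toReal_coe]
    apply ENNReal.ofReal_le_ofReal
    rw [inner_smul_right] at hf
    have h1 : ⟪x, q⟫ - μ * φ ≤ μ * F := by
      have := mul_le_mul_of_nonneg_left hf hμ.le
      rw [mul_sub, ← mul_assoc, mul_inv_cancel₀ hμ.ne', one_mul] at this
      exact this
    have h2 : ⟪q, μ • v⟫ ≤ 1 / 2 * ‖q‖ ^ 2 + 1 / 2 * ‖μ • v‖ ^ 2 := by
      have := real_inner_le_norm q (μ • v)
      nlinarith [sq_nonneg (‖q‖ - ‖μ • v‖)]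
    rw [inner_sub_right, inner_add_right]
    rw [real_inner_comm] at h1
    linarith

/-- Under `(H1)_ε`, `(H2)_ε` and `Φ(0) < +∞`: (ii) `x(t)` and
`y(t) = x(t) + μ v(t)` converge weakly to the projection of the origin onto `argmin Φ`;
(iii) `v(t) → 0` strongly, and hence `x(t) - y(t) → 0` strongly. -/
theorem stmt11 (Φ : H → EReal) (hproper : ProperFn Φ) (hconv : EConvexOn Φ)
    (hlsc : LowerSemicontinuous Φ) (hnn : ∀ x, 0 ≤ Φ x) (hΦ0 : Φ 0 ≠ ⊤)
    (C : Set H) (hC : C = {x : H | Φ x = 0}) (hCne : C.Nonempty)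
    (lam μ : ℝ) (hlam : 0 < lam) (hμ : μ = 1 / lam)
    (ε ε' : ℝ → ℝ) (hεnn : ∀ t, 0 ≤ ε t)
    (H1 : ∀ p : H, (∃ x ∈ C, ∀ c ∈ C, ⟪p, c - x⟫ ≤ (0 : ℝ)) →
      ∫⁻ t in Set.Ioi (0:ℝ),
        eToENN ((μ : EReal) * fenchel Φ (μ⁻¹ • (ε t • p)) - suppFn C (ε t • p)
          + (((1 / 2) * ‖ε t • p‖ ^ 2 : ℝ) : EReal)) < ⊤)
    (hεderiv : ∀ t ∈ Set.Ici (0:ℝ), HasDerivAt ε (ε' t) t)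
    (hεC1 : ContinuousOn ε' (Set.Ici (0:ℝ)))
    (hεmono : AntitoneOn ε (Set.Ici (0:ℝ)))
    (hεlip : ∃ K : NNReal, LipschitzOnWith K ε (Set.Ici (0:ℝ)))
    (hεlim : Tendsto ε atTop (𝓝 0))
    (hεdiv : ∫⁻ t in Set.Ioi (0:ℝ), ENNReal.ofReal (ε t) = ⊤)
    (hεk : ∃ k : ℝ, 0 ≤ k ∧ ∀ t ∈ Set.Ici (0:ℝ), -k * (ε t) ^ 2 ≤ ε' t)
    (x v : ℝ → H) (hsol : IsStrongSol Φ lam ε x v) :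
    ∃ l : H, l ∈ C ∧ (∀ c ∈ C, ‖l‖ ≤ ‖c‖) ∧
      (∀ z : H, Tendsto (fun t : ℝ => (⟪x t, z⟫ : ℝ)) atTop (𝓝 (⟪l, z⟫ : ℝ))) ∧
      (∀ z : H, Tendsto (fun t : ℝ => (⟪x t + μ • v t, z⟫ : ℝ)) atTop (𝓝 (⟪l, z⟫ : ℝ))) ∧
      Tendsto v atTop (𝓝 (0 : H)) ∧
      Tendsto (fun t : ℝ => x t - (x t + μ • v t)) atTop (𝓝 (0 : H)) := by
  have hμ0 : 0 < μ := by rw [hμ]; positivity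
  have hlm : μ * lam = 1 := by rw [hμ]; field_simp
  -- projection
  obtain ⟨l, hl, hlproj⟩ : ∃ l ∈ C, ∀ c ∈ C, ⟪(0:H) - l, c - l⟫ ≤ (0:ℝ) := by
    have hcl : IsClosed C := by
      have := hlsc.isClosed_preimage 0
      convert this using 1
      rw [hC]; ext z
      simp only [mem_ofPred_eq, mem_preimage, mem_Iic]
      exact ⟨fun h => h.le, fun h => le_antisymm h (hnn z)⟩
    have hcv : Convex ℝ C := by
      intro z hz w hw a b ha hb hab
      rw [hC] at hz hw ⊢
      have := hconv z w a b ha hb hab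
      rw [hz, hw, mul_zero, mul_zero, add_zero] at this
      exact le_antisymm this (hnn _)
    obtain ⟨l, hl, h⟩ := exists_norm_eq_iInf_of_complete_convex hCne hcl.isComplete hcv 0
    exact ⟨l, hl, (norm_eq_iInf_iff_real_inner_le_zero hcv hl).mp h⟩
  have hmin : ∀ c ∈ C, ‖l‖ ≤ ‖c‖ := by
    intro c hc
    have h1 := hlproj c hc
    rw [zero_sub, inner_neg_left, inner_sub_right, real_inner_self_eq_norm_sq] at h1
    have h2 := real_inner_le_norm l c
    by_contra hlt
    push Not at hlt
    nlinarith [norm_nonneg c, norm_nonneg l]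
  have hΦl : Φ l = 0 := by rw [hC] at hl; exact hl
  obtain ⟨x', v', hint, hx, hv, hsub, hode⟩ := hsol
  have hxc := cont_prim x x' (fun b hb => (hint b hb).1) hx
  have hvc := cont_prim v v' (fun b hb => (hint b hb).2) hv
  have hεc : ContinuousOn ε (Set.Ici 0) :=
    fun t ht => (hεderiv t ht).continuousAt.continuousWithinAt
  set r : ℝ → H := fun t => -(μ • (v t + ε t • x t)) with hr
  have hrc : ContinuousOn r (Set.Ici 0) :=
    (continuousOn_const.smul (hvc.add (hεc.smul hxc))).neg
  set y : ℝ → H := fun t => x t + μ • v t with hy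
  have hyint : ∀ t, 0 ≤ t → y t = y 0 + ∫ s in (0:ℝ)..t, r s := by
    intro t ht
    have hb : IntervalIntegrable x' volume 0 t ∧ IntervalIntegrable v' volume 0 t := by
      rcases ht.eq_or_lt with h | h
      · subst h; simp
      · exact hint t h
    have : ∫ s in (0:ℝ)..t, r s = ∫ s in (0:ℝ)..t, (x' s + μ • v' s) := by
      apply intervalIntegral.integral_congr_ae
      rw [ae_restrict_iff' measurableSet_Ici] at hode
      filter_upwards [hode] with s hs hs2
      rw [uIoc_of_le ht] at hs2
      have h1 := hs hs2.1.le
      have h2 : x' s + μ • v' s = r s + μ • (lam • x' s + v' s + v s + ε s • x s) := by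
        simp only [hr, smul_add, smul_smul, hlm, one_smul]
        abel
      rw [h2, h1, smul_zero, add_zero]
    have hb2 : IntervalIntegrable (fun s => μ • v' s) volume 0 t := hb.2.smul μ
    rw [this, intervalIntegral.integral_add hb.1 hb2, intervalIntegral.integral_smul]
    simp only [hy]
    rw [hx t ht, hv t ht, smul_add]
    abel
  have hyd : ∀ t, 0 < t → HasDerivAt y (r t) t := by
    intro t ht
    have hmem : Set.Ici (0:ℝ) ∈ 𝓝 t := Ici_mem_nhds ht
    have h1 : HasDerivAt (fun u => ∫ s in (0:ℝ)..u, r s) (r t) t := by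
      refine intervalIntegral.integral_hasDerivAt_right ?_ ?_ (hrc.continuousAt hmem)
      · refine (hrc.mono ?_).intervalIntegrable
        rw [uIcc_of_le ht.le]; exact Icc_subset_Ici_self
      · exact (hrc.mono Ioi_subset_Ici_self).stronglyMeasurableAtFilter isOpen_Ioi t ht
    refine (h1.const_add (y 0)).congr_of_eventuallyEq ?_
    filter_upwards [hmem] with u hu using hyint u hu
  -- pointwise facts
  have hpt : ∀ t, 0 ≤ t → ∃ φ : ℝ, Φ (x t) = φ ∧ 0 ≤ φ ∧ φ ≤ ⟪v t, x t - l⟫ := by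
    intro t ht
    have h1 := hsub t ht l
    rw [hΦl] at h1
    have h0 := hnn (x t)
    generalize Φ (x t) = F at h1 h0
    induction F with
    | bot => simp at h0
    | top => rw [EReal.top_add_coe] at h1; simp at h1
    | coe φ =>
      refine ⟨φ, rfl, by exact_mod_cast h0, ?_⟩
      rw [← EReal.coe_add] at h1
      have h1 : φ + ⟪v t, l - x t⟫ ≤ 0 := by exact_mod_cast h1
      rw [← neg_sub (x t) l, inner_neg_right] at h1
      linarith
  have hlim : Tendsto (fun t => ‖y t - l‖ ^ 2) atTop (𝓝 0) := by
    obtain ⟨T, hT⟩ := ((hεlim.eventually (gt_mem_nhds (show (0:ℝ) < 1 / (2 * μ) by positivity))).and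
      (eventually_ge_atTop (1:ℝ))).exists_forall_of_atTop
    have hT0 : 0 < T := lt_of_lt_of_le one_pos (hT T le_rfl).2
    have hp := H1 (-((2 * μ) • l)) ⟨l, hl, fun c hc => by
      have := hlproj c hc
      rw [zero_sub, inner_neg_left] at this
      rw [inner_neg_left, inner_smul_left]
      simp only [conj_trivial]
      have h3 : 0 ≤ 2 * μ * ⟪l, c - l⟫ := mul_nonneg (by positivity) (by linarith)
      linarith⟩
    refine scalar_lim (fun t => ‖y t - l‖ ^ 2) (fun t => 2 * ⟪y t - l, r t⟫) ε (2 * μ) T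
      (by positivity) hT0 (fun t => by positivity) hεnn hεc hεdiv ?_ ?_ _ hp ?_
    · intro t ht
      exact ((hyd t ht).sub_const l).norm_sq
    · have hyc : ContinuousOn y (Set.Ici 0) := hxc.add (continuousOn_const.smul hvc)
      exact (continuousOn_const.mul ((hyc.sub continuousOn_const).inner hrc)).mono
        Ioi_subset_Ici_self
    · intro t ht
      have ht0 : 0 ≤ t := hT0.le.trans ht
      obtain ⟨φ, hφ, hφ0, hφv⟩ := hpt t ht0
      have hεt : μ * ε t ≤ 1 / 2 := by
        have := (hT t ht).1.le
        rw [le_div_iff₀ (by positivity)] at this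
        linarith
      have hεt0 := hεnn t
      refine le_trans ?_ (fenchel_bound Φ μ hμ0 C l (ε t • -((2 * μ) • l)) (x t) (v t) φ hφ hl ?_)
      · apply ENNReal.ofReal_le_ofReal
        -- in terms of w = μ v, u = y - l
        have e1 : r t = -((1 - μ * ε t) • (μ • v t)) - (μ * ε t) • (y t - l) - (μ * ε t) • l := by
          simp only [hr, hy]
          module
        have e2 : x t + μ • v t - l = y t - l := rfl
        rw [e2, e1]
        have e3 : ⟪y t - l, μ • v t⟫ = μ * ⟪v t, x t - l⟫ + ‖μ • v t‖ ^ 2 := by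
          have : y t - l = (x t - l) + μ • v t := by simp only [hy]; abel
          rw [this, inner_add_left, real_inner_self_eq_norm_sq, inner_smul_right, real_inner_comm]
        beta_reduce
        generalize y t - l = u at e3 ⊢
        generalize μ • v t = w at e3 ⊢
        rw [inner_sub_right, inner_sub_right, inner_neg_right]
        simp only [inner_smul_right, inner_smul_left, inner_neg_left, conj_trivial,
          real_inner_self_eq_norm_sq, e3, real_inner_comm u l]
        have h5 : μ * φ ≤ μ * ⟪v t, x t - l⟫ := mul_le_mul_of_nonneg_left hφv hμ0.le
        have h6 : 0 ≤ μ * φ := mul_nonneg hμ0.le hφ0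
        have h7 : 0 ≤ ‖w‖ ^ 2 := by positivity
        nlinarith [mul_nonneg (sub_nonneg.mpr hεt) (show 0 ≤ μ * ⟪v t, x t - l⟫ + ‖w‖ ^ 2 by linarith)]
      · intro c hc
        have := hlproj c hc
        rw [zero_sub, inner_neg_left] at this
        simp only [inner_neg_left, inner_smul_left, conj_trivial]
        have h3 : 0 ≤ ε t * (2 * μ * ⟪l, c - l⟫) :=
          mul_nonneg hεt0 (mul_nonneg (by positivity) (by linarith))
        linarith
  have hnorm : Tendsto (fun t => ‖y t - l‖) atTop (𝓝 0) := by
    have := hlim.sqrt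
    simpa [Real.sqrt_sq] using this
  have hylim : Tendsto y atTop (𝓝 l) := tendsto_iff_norm_sub_tendsto_zero.mpr hnorm
  have hμv : Tendsto (fun t => μ • v t) atTop (𝓝 0) := by
    refine squeeze_zero_norm' ?_ hnorm
    filter_upwards [eventually_ge_atTop 0] with t ht
    obtain ⟨φ, hφ, hφ0, hφv⟩ := hpt t ht
    have e3 : ⟪y t - l, μ • v t⟫ = μ * ⟪v t, x t - l⟫ + ‖μ • v t‖ ^ 2 := by
      have : y t - l = (x t - l) + μ • v t := by simp only [hy]; abel
      rw [this, inner_add_left, real_inner_self_eq_norm_sq, inner_smul_right, real_inner_comm]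
    have h1 := real_inner_le_norm (y t - l) (μ • v t)
    have h2 : 0 ≤ μ * ⟪v t, x t - l⟫ := mul_nonneg hμ0.le (hφ0.trans hφv)
    by_contra hlt
    push Not at hlt
    nlinarith [norm_nonneg (y t - l), norm_nonneg (μ • v t)]
  have hvlim : Tendsto v atTop (𝓝 0) := by
    have := hμv.const_smul μ⁻¹
    simpa [smul_smul, inv_mul_cancel₀ hμ0.ne'] using this
  have hxlim : Tendsto x atTop (𝓝 l) := by
    have := hylim.sub hμv
    simpa [hy] using this
  refine ⟨l, hl, hmin, fun z => hxlim.inner tendsto_const_nhds,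
    fun z => hylim.inner tendsto_const_nhds, hvlim, ?_⟩
  have := hμv.neg
  simpa using this
end
end
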